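/- arXiv:2601.08362 — 4 statements merged into one kernel-verified Lean document; each statement's English description precedes it below -/
import Mathlib

section
/- For all integers p,q ≥ 0 with p+q ≤ n and every A ∈ M_{p,q}, there exist an open neighborhood U of A in S^n and a C^∞ map Φ : U → S^n such that Φ(A') = Π_+(A') for every A' ∈ U ∩ M_{p,q}. In particular, the restriction of the metric projection Π_+ to each stratum M_{p,q} is C^∞. -/
open scoped Classical RealInnerProductSpace
open Matrix Set

noncomputable section

abbrev Mat (n : ℕ) : Type := Matrix (Fin n) (Fin n) ℝ

abbrev Em (m : ℕ) : Type := EuclideanSpace ℝ (Fin m)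

attribute [instance] Matrix.frobeniusNormedAddCommGroup Matrix.frobeniusNormedSpace

/-- The trace (Frobenius) inner product `⟨A,B⟩ = tr(AᵀB)` on matrices; for symmetric
matrices this is `tr(AB)`. -/
def minner {n : ℕ} (A B : Mat n) : ℝ := (Aᵀ * B).trace

/-- `P` is an orthogonal matrix. -/
def IsOrthoMat {n : ℕ} (P : Mat n) : Prop := P * Pᵀ = 1 ∧ Pᵀ * P = 1

/-- `(P, lam)` is an eigenvalue decomposition of `A` with orthogonal `P` and
nonincreasing eigenvalue vector `lam`: `A = P·Diag(lam)·Pᵀ`. -/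
def IsEigDecomp {n : ℕ} (A P : Mat n) (lam : Fin n → ℝ) : Prop :=
  IsOrthoMat P ∧ Antitone lam ∧ A = P * Matrix.diagonal lam * Pᵀ

/-- The stratum `M_{p,q}` of symmetric matrices with exactly `p` positive and `q` negative
eigenvalues. -/
def stratum (n p q : ℕ) : Set (Mat n) :=
  {A | ∃ P lam, IsEigDecomp A P lam ∧
    {i : Fin n | 0 < lam i}.ncard = p ∧ {i : Fin n | lam i < 0}.ncard = q}

/-- The metric projection `Π₊` onto the positive semidefinite cone (defined through an
eigenvalue decomposition; the value is independent of the choice of decomposition). -/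
noncomputable def piPlus {n : ℕ} (A : Mat n) : Mat n :=
  if h : ∃ P lam, IsEigDecomp A P lam then
    h.choose * Matrix.diagonal (fun i => max (h.choose_spec.choose i) 0) * h.chooseᵀ
  else 0

variable {m n : ℕ}

/-- `G(z) = g(x) + y`. -/
def Gmap (g : Em m → Mat n) (z : Em m × Mat n) : Mat n := g z.1 + z.2

/-- The adjoint `∇g(x) : Sⁿ → ℝᵐ` of the derivative `g'(x)`, characterized by
`⟨∇g(x)H, v⟩ = ⟨H, g'(x)v⟩`. -/
def gradg (g : Em m → Mat n) (x : Em m) (H : Mat n) : Em m :=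
  (EuclideanSpace.equiv (Fin m) ℝ).symm
    fun k => (Hᵀ * fderiv ℝ g x (EuclideanSpace.single k 1)).trace

/-- The Lagrangian `L(x,y) = f(x) + ⟨y, g(x)⟩`. -/
def Lfun (f : Em m → ℝ) (g : Em m → Mat n) (x : Em m) (y : Mat n) : ℝ :=
  f x + minner y (g x)

/-- The Hessian `∇²ₓₓL(x,y)` of `x ↦ L(x,y)`, as a continuous linear map `ℝᵐ → ℝᵐ`. -/
def hessL (f : Em m → ℝ) (g : Em m → Mat n) (x : Em m) (y : Mat n) : Em m →L[ℝ] Em m :=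
  fderiv ℝ (fun u => gradient (fun w => Lfun f g w y) u) x

/-- The KKT mapping `F(z) = (∇f(x) + ∇g(x)y, −g(x) + Π₊(G(z)))`. -/
def KKTF (f : Em m → ℝ) (g : Em m → Mat n) (z : Em m × Mat n) : Em m × Mat n :=
  (gradient f z.1 + gradg g z.1 z.2, - g z.1 + piPlus (Gmap g z))

/-- The lifted stratum `M̃_{p,q} = {z = (x,y) ∈ ℝᵐ × Sⁿ : G(z) ∈ M_{p,q}}`. -/
def lstratum (g : Em m → Mat n) (p q : ℕ) : Set (Em m × Mat n) :=
  {z | z.2.IsSymm ∧ Gmap g z ∈ stratum n p q}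

/-- The norm `‖(u,H)‖ = sqrt(‖u‖² + ‖H‖²)` on `ℝᵐ × Sⁿ` (Frobenius norm on matrices). -/
def pnorm {m n : ℕ} (w : Em m × Mat n) : ℝ := Real.sqrt (‖w.1‖ ^ 2 + ‖w.2‖ ^ 2)

/-- The weak strict Robinson constraint qualification (W-SRCQ) at `z`:
`g'(x)[ℝᵐ] + {PBPᵀ : B ∈ Sⁿ, B_{βγ} = 0, B_{γγ} = 0} = Sⁿ`
(for any eigenvalue decomposition `(P, lam)` of `G(z)`; independent of the choice). -/
def WSRCQ (g : Em m → Mat n) (z : Em m × Mat n) : Prop :=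
  ∀ P lam, IsEigDecomp (Gmap g z) P lam →
    ∀ C : Mat n, C.IsSymm →
      ∃ (v : Em m) (B : Mat n), B.IsSymm ∧
        (∀ i j, lam i = 0 → lam j < 0 → B i j = 0) ∧
        (∀ i j, lam i < 0 → lam j < 0 → B i j = 0) ∧
        C = fderiv ℝ g z.1 v + P * B * Pᵀ

/-- The constraint nondegeneracy at `z`:
`g'(x)[ℝᵐ] + {PBPᵀ : B ∈ Sⁿ, B_{ββ} = 0, B_{βγ} = 0, B_{γγ} = 0} = Sⁿ`. -/
def CNondeg (g : Em m → Mat n) (z : Em m × Mat n) : Prop :=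
  ∀ P lam, IsEigDecomp (Gmap g z) P lam →
    ∀ C : Mat n, C.IsSymm →
      ∃ (v : Em m) (B : Mat n), B.IsSymm ∧
        (∀ i j, lam i = 0 → lam j = 0 → B i j = 0) ∧
        (∀ i j, lam i = 0 → lam j < 0 → B i j = 0) ∧
        (∀ i j, lam i < 0 → lam j < 0 → B i j = 0) ∧
        C = fderiv ℝ g z.1 v + P * B * Pᵀ

/-- The strict Robinson constraint qualification (SRCQ) at a KKT pair `z`:
`g'(x)[ℝᵐ] + {PBPᵀ : B ∈ Sⁿ, B_{ββ} ⪰ 0, B_{βγ} = 0, B_{γγ} = 0} = Sⁿ`. -/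
def SRCQ (g : Em m → Mat n) (z : Em m × Mat n) : Prop :=
  ∀ P lam, IsEigDecomp (Gmap g z) P lam →
    ∀ C : Mat n, C.IsSymm →
      ∃ (v : Em m) (B : Mat n), B.IsSymm ∧
        (∀ u : Fin n → ℝ, (∀ i, lam i ≠ 0 → u i = 0) →
          0 ≤ ∑ i, ∑ j, u i * B i j * u j) ∧
        (∀ i j, lam i = 0 → lam j < 0 → B i j = 0) ∧
        (∀ i j, lam i < 0 → lam j < 0 → B i j = 0) ∧
        C = fderiv ℝ g z.1 v + P * B * Pᵀ

/-- The quadratic form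
`Q(z,v) = ⟨v, ∇²ₓₓL(x,y)v⟩ + 2·Σ_{i∈α}Σ_{j∈γ} (−λⱼ/λᵢ)·([Pᵀ(g'(x)v)P]_{ij})²`. -/
def Qform (f : Em m → ℝ) (g : Em m → Mat n) (z : Em m × Mat n)
    (P : Mat n) (lam : Fin n → ℝ) (v : Em m) : ℝ :=
  ⟪v, hessL f g z.1 z.2 v⟫ +
    2 * ∑ i : Fin n, ∑ j : Fin n,
      (if 0 < lam i ∧ lam j < 0 then
        (-lam j / lam i) * ((Pᵀ * fderiv ℝ g z.1 v * P) i j) ^ 2 else 0)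

/-- `v ∈ appl(z)`: the blocks `ββ`, `βγ`, `γγ` of `Pᵀ(g'(x)v)P` vanish. -/
def memAppl (g : Em m → Mat n) (z : Em m × Mat n)
    (P : Mat n) (lam : Fin n → ℝ) (v : Em m) : Prop :=
  (∀ i j, lam i = 0 → lam j = 0 → (Pᵀ * fderiv ℝ g z.1 v * P) i j = 0) ∧
  (∀ i j, lam i = 0 → lam j < 0 → (Pᵀ * fderiv ℝ g z.1 v * P) i j = 0) ∧
  (∀ i j, lam i < 0 → lam j < 0 → (Pᵀ * fderiv ℝ g z.1 v * P) i j = 0)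

/-- `v ∈ app(z)`: the blocks `βγ`, `γγ` of `Pᵀ(g'(x)v)P` vanish. -/
def memApp (g : Em m → Mat n) (z : Em m × Mat n)
    (P : Mat n) (lam : Fin n → ℝ) (v : Em m) : Prop :=
  (∀ i j, lam i = 0 → lam j < 0 → (Pᵀ * fderiv ℝ g z.1 v * P) i j = 0) ∧
  (∀ i j, lam i < 0 → lam j < 0 → (Pᵀ * fderiv ℝ g z.1 v * P) i j = 0)

/-- The weak second order condition (W-SOC) at `z`: `Q(z,v) ≠ 0` for every nonzero
`v ∈ appl(z)`. -/
def WSOC (f : Em m → ℝ) (g : Em m → Mat n) (z : Em m × Mat n) : Prop :=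
  ∀ P lam, IsEigDecomp (Gmap g z) P lam →
    ∀ v : Em m, v ≠ 0 → memAppl g z P lam v → Qform f g z P lam v ≠ 0

/-- The strong second order sufficient condition (S-SOSC) at `z`: `Q(z,v) > 0` for every
nonzero `v ∈ app(z)`. -/
def SSOSC (f : Em m → ℝ) (g : Em m → Mat n) (z : Em m × Mat n) : Prop :=
  ∀ P lam, IsEigDecomp (Gmap g z) P lam →
    ∀ v : Em m, v ≠ 0 → memApp g z P lam v → 0 < Qform f g z P lam v

/-- The second order necessary condition (SONC) at `z`. -/
def SONC (f : Em m → ℝ) (g : Em m → Mat n) (z : Em m × Mat n) : Prop :=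
  ∀ P lam, IsEigDecomp (Gmap g z) P lam →
    ∀ v : Em m, v ≠ 0 →
      (∀ u : Fin n → ℝ, (∀ i, lam i ≠ 0 → u i = 0) →
        0 ≤ ∑ i, ∑ j, u i * (Pᵀ * fderiv ℝ g z.1 v * P) i j * u j) →
      memApp g z P lam v → 0 ≤ Qform f g z P lam v

/-- The W-SOC holds uniformly on a set `S`: there is `c > 0` with `Q(z,v) ≥ c‖v‖²` for
every `z ∈ S` (in `ℝᵐ × Sⁿ`) and every `v ∈ appl(z)`. -/
def UnifWSOC (f : Em m → ℝ) (g : Em m → Mat n) (S : Set (Em m × Mat n)) : Prop :=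
  ∃ c : ℝ, 0 < c ∧ ∀ z ∈ S, z.2.IsSymm →
    ∀ P lam, IsEigDecomp (Gmap g z) P lam →
      ∀ v : Em m, memAppl g z P lam v → c * ‖v‖ ^ 2 ≤ Qform f g z P lam v

/-- `H ∈ T_z`: `H ∈ Sⁿ` with `(PᵀHP)_{ββ} = 0`. -/
def memTz {n : ℕ} (P : Mat n) (lam : Fin n → ℝ) (H : Mat n) : Prop :=
  H.IsSymm ∧ ∀ i j, lam i = 0 → lam j = 0 → (Pᵀ * H * P) i j = 0

/-- `Δ ∈ N_{G(z)}M_{p,q}`: `Δ ∈ Sⁿ` and `(PᵀΔP)_{ij} = 0` whenever `i ∉ β` or `j ∉ β`. -/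
def memNormal {n : ℕ} (P : Mat n) (lam : Fin n → ℝ) (Δ : Mat n) : Prop :=
  Δ.IsSymm ∧ ∀ i j, (lam i ≠ 0 ∨ lam j ≠ 0) → (Pᵀ * Δ * P) i j = 0

/-- The map `ξ_z : T_z → Sⁿ`, `ξ_z(H) = P·M·Pᵀ`. -/
def xiMap {n : ℕ} (P : Mat n) (lam : Fin n → ℝ) (H : Mat n) : Mat n :=
  P * (Matrix.of fun i j =>
    if 0 < lam i ∧ 0 < lam j then (Pᵀ * H * P) i j
    else if 0 < lam i ∧ lam j = 0 then (Pᵀ * H * P) i j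
    else if lam i = 0 ∧ 0 < lam j then (Pᵀ * H * P) i j
    else if 0 < lam i ∧ lam j < 0 then (lam i / (lam i - lam j)) * (Pᵀ * H * P) i j
    else if lam i < 0 ∧ 0 < lam j then (lam j / (lam j - lam i)) * (Pᵀ * H * P) i j
    else 0) * Pᵀ

/-- The linear map `𝒜_z(v,H) = (∇²ₓₓL(x,y)v − ∇g(x)(g'(x)v) + ∇g(x)H, −g'(x)v + ξ_z(H))`. -/
def Amap (f : Em m → ℝ) (g : Em m → Mat n) (z : Em m × Mat n)
    (P : Mat n) (lam : Fin n → ℝ) (v : Em m) (H : Mat n) : Em m × Mat n :=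
  (hessL f g z.1 z.2 v - gradg g z.1 (fderiv ℝ g z.1 v) + gradg g z.1 H,
    - fderiv ℝ g z.1 v + xiMap P lam H)

/-- The positive inertia index of `A` is `p`. -/
def posInertiaIs {n : ℕ} (A : Mat n) (p : ℕ) : Prop :=
  ∃ P lam, IsEigDecomp A P lam ∧ {i : Fin n | 0 < lam i}.ncard = p

/-- The negative inertia index of `A` is `q`. -/
def negInertiaIs {n : ℕ} (A : Mat n) (q : ℕ) : Prop :=
  ∃ P lam, IsEigDecomp A P lam ∧ {i : Fin n | lam i < 0}.ncard = q

end

section SpectralProjection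

open Filter Topology
open scoped ContDiff

variable {n : ℕ}

/-- The matrix `P·Diag(d)·Pᵀ`. -/
def conjDiag (P : Mat n) (d : Fin n → ℝ) : Mat n := P * Matrix.diagonal d * Pᵀ

lemma conjDiag_mul {P : Mat n} (hP : IsOrthoMat P) (d e : Fin n → ℝ) :
    conjDiag P d * conjDiag P e = conjDiag P (fun i => d i * e i) := by
  unfold conjDiag
  rw [← Matrix.diagonal_mul_diagonal]
  calc _ = P * diagonal d * (Pᵀ * P) * diagonal e * Pᵀ := by simp only [Matrix.mul_assoc]
    _ = _ := by rw [hP.2]; simp only [Matrix.mul_one, Matrix.mul_assoc]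

lemma conjDiag_add (P : Mat n) (d e : Fin n → ℝ) :
    conjDiag P d + conjDiag P e = conjDiag P (fun i => d i + e i) := by
  unfold conjDiag
  rw [← Matrix.diagonal_add, Matrix.mul_add, Matrix.add_mul]

lemma conjDiag_smul (P : Mat n) (c : ℝ) (d : Fin n → ℝ) :
    c • conjDiag P d = conjDiag P (fun i => c * d i) := by
  unfold conjDiag
  have : diagonal (fun i => c * d i) = c • diagonal d := by
    rw [← Matrix.diagonal_smul]; rfl
  rw [this, Matrix.mul_smul, Matrix.smul_mul]

lemma conjDiag_one {P : Mat n} (hP : IsOrthoMat P) : conjDiag P (fun _ => 1) = 1 := by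
  unfold conjDiag
  rw [Matrix.diagonal_one, Matrix.mul_one, hP.1]

lemma conjDiag_sub_smul_one {P : Mat n} (hP : IsOrthoMat P) (d : Fin n → ℝ) (c : ℝ) :
    conjDiag P d - c • (1 : Mat n) = conjDiag P (fun i => d i - c) := by
  rw [← conjDiag_one hP, sub_eq_add_neg, ← neg_smul, conjDiag_smul, conjDiag_add]
  congr 1; ext i; ring

lemma conjDiag_transpose (P : Mat n) (d : Fin n → ℝ) : (conjDiag P d)ᵀ = conjDiag P d := by
  simp [conjDiag, Matrix.transpose_mul, Matrix.mul_assoc]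

lemma conjDiag_trace {P : Mat n} (hP : IsOrthoMat P) (d : Fin n → ℝ) :
    (conjDiag P d).trace = ∑ i, d i := by
  unfold conjDiag
  rw [Matrix.trace_mul_comm, ← Matrix.mul_assoc, hP.2, Matrix.one_mul, Matrix.trace_diagonal]

lemma conjDiag_posSemidef (P : Mat n) {d : Fin n → ℝ} (hd : ∀ i, 0 ≤ d i) :
    (conjDiag P d).PosSemidef :=
  (PosSemidef.diagonal (show 0 ≤ d from hd)).mul_mul_conjTranspose_same P

lemma isUnit_conjDiag_iff {P : Mat n} (hP : IsOrthoMat P) {d : Fin n → ℝ} :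
    IsUnit (conjDiag P d) ↔ ∀ i, d i ≠ 0 := by
  have hdet : P.det * P.det = 1 := by
    have := congrArg Matrix.det hP.1
    simpa using this
  have h0 : P.det ≠ 0 := fun h => by simp [h] at hdet
  rw [Matrix.isUnit_iff_isUnit_det, conjDiag, Matrix.det_mul, Matrix.det_mul, Matrix.det_transpose,
    Matrix.det_diagonal, isUnit_iff_ne_zero]
  simp [h0, Finset.prod_ne_zero_iff]

/-- The functional calculus `f ↦ P·Diag(f ∘ lam)·Pᵀ` does not depend on the
choice of the decomposition. -/
lemma conjDiag_comp_eq {P Q : Mat n} (hP : IsOrthoMat P) (hQ : IsOrthoMat Q)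
    {lam mu : Fin n → ℝ} (h : conjDiag P lam = conjDiag Q mu) (f : ℝ → ℝ) :
    conjDiag P (f ∘ lam) = conjDiag Q (f ∘ mu) := by
  have key : ∀ g : ℝ → ℝ, conjDiag P (g ∘ lam) = conjDiag Q (g ∘ mu) ↔
      (Qᵀ * P) * diagonal (g ∘ lam) = diagonal (g ∘ mu) * (Qᵀ * P) := by
    intro g
    unfold conjDiag
    constructor
    · intro e
      calc _ = Qᵀ * (P * diagonal (g ∘ lam) * (Pᵀ * P)) := by
            rw [hP.2, Matrix.mul_one, Matrix.mul_assoc]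
        _ = Qᵀ * (P * diagonal (g ∘ lam) * Pᵀ) * P := by simp only [Matrix.mul_assoc]
        _ = (Qᵀ * Q) * diagonal (g ∘ mu) * (Qᵀ * P) := by rw [e]; simp only [Matrix.mul_assoc]
        _ = _ := by rw [hQ.2, Matrix.one_mul]
    · intro e
      calc _ = (Q * Qᵀ) * P * diagonal (g ∘ lam) * Pᵀ := by rw [hQ.1, Matrix.one_mul]
        _ = Q * ((Qᵀ * P) * diagonal (g ∘ lam)) * Pᵀ := by simp only [Matrix.mul_assoc]
        _ = Q * diagonal (g ∘ mu) * Qᵀ * (P * Pᵀ) := by rw [e]; simp only [Matrix.mul_assoc]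
        _ = _ := by rw [hP.1, Matrix.mul_one]
  have h1 := (key id).1 h
  refine (key f).2 ?_
  ext i j
  have h2 := congrFun (congrFun h1 i) j
  simp only [Matrix.mul_diagonal, Matrix.diagonal_mul, Function.comp, id] at h2 ⊢
  by_cases h0 : (Qᵀ * P) i j = 0
  · simp [h0]
  · rw [mul_comm] at h2
    rw [mul_right_cancel₀ h0 h2, mul_comm]

lemma piPlus_eq {A P : Mat n} {lam : Fin n → ℝ} (h : IsEigDecomp A P lam) :
    piPlus A = conjDiag P (fun i => max (lam i) 0) := by
  have hex : ∃ P lam, IsEigDecomp A P lam := ⟨P, lam, h⟩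
  have hs := hex.choose_spec.choose_spec
  rw [piPlus, dif_pos hex]
  exact conjDiag_comp_eq hs.1 h.1 (hs.2.2.symm.trans h.2.2) (fun x => max x 0)

lemma frobenius_sq (H : Mat n) : ‖H‖ ^ 2 = (Hᵀ * H).trace := by
  rw [Matrix.frobenius_norm_def, ← Real.sqrt_eq_rpow, Real.sq_sqrt (by positivity),
    Matrix.trace, Finset.sum_comm]
  simp [Matrix.mul_apply, pow_two]

lemma abs_trace_transpose_mul_le (H K : Mat n) : |(Hᵀ * K).trace| ≤ ‖H‖ * ‖K‖ := by
  have hs : ∀ A B : Mat n, (Aᵀ * B).trace = ∑ x : Fin n × Fin n, A x.1 x.2 * B x.1 x.2 := by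
    intro A B
    rw [Fintype.sum_prod_type, Finset.sum_comm, Matrix.trace]
    simp [Matrix.mul_apply]
  refine abs_le_of_sq_le_sq ?_ (by positivity)
  rw [mul_pow, frobenius_sq, frobenius_sq, hs, hs, hs]
  simpa [pow_two] using Finset.sum_mul_sq_le_sq_mul_sq Finset.univ
    (fun x : Fin n × Fin n => H x.1 x.2) (fun x => K x.1 x.2)

/-- Injectivity of the Sylvester operator `H ↦ X·H + H·Y` for `Y` positive semidefinite
and `X` close to a positive definite matrix. -/
lemma sylvester_eq_zero {S X Y H : Mat n} {c : ℝ} (hS : (S - c • (1 : Mat n)).PosSemidef)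
    (hX : ‖X - S‖ < c) (hY : Y.PosSemidef) (h : X * H + H * Y = 0) : H = 0 := by
  have h1 : 0 ≤ (Hᵀ * (S - c • (1 : Mat n)) * H).trace :=
    (hS.conjTranspose_mul_mul_same H).trace_nonneg
  have h2 : 0 ≤ (H * Y * Hᵀ).trace := (hY.mul_mul_conjTranspose_same H).trace_nonneg
  have h3 : (Hᵀ * (X * H)).trace + (H * Y * Hᵀ).trace = 0 := by
    rw [Matrix.trace_mul_comm (H * Y), ← Matrix.trace_add, ← Matrix.mul_add, h]
    simp
  have h4 : Hᵀ * (X * H) =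
      Hᵀ * (S - c • (1 : Mat n)) * H + c • (Hᵀ * H) + Hᵀ * ((X - S) * H) := by
    simp only [Matrix.mul_sub, Matrix.sub_mul, Matrix.mul_assoc, Matrix.mul_smul, Matrix.smul_mul,
      Matrix.one_mul]
    abel
  have h5 : (Hᵀ * (X * H)).trace = (Hᵀ * (S - c • (1 : Mat n)) * H).trace + c * ‖H‖ ^ 2 +
      (Hᵀ * ((X - S) * H)).trace := by
    rw [h4, Matrix.trace_add, Matrix.trace_add, Matrix.trace_smul, frobenius_sq, smul_eq_mul]
  have h6 : |(Hᵀ * ((X - S) * H)).trace| ≤ ‖X - S‖ * ‖H‖ ^ 2 :=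
    (abs_trace_transpose_mul_le _ _).trans <|
      (mul_le_mul_of_nonneg_left (Matrix.frobenius_norm_mul _ _) (norm_nonneg _)).trans_eq
        (by ring)
  have h7 := (abs_le.1 h6).1
  have h8 : (c - ‖X - S‖) * ‖H‖ ^ 2 ≤ 0 := by nlinarith
  have h9 : ‖H‖ ^ 2 ≤ 0 := by
    by_contra! hlt
    exact absurd h8 (not_le.2 (mul_pos (sub_pos.2 hX) hlt))
  exact norm_eq_zero.1 (pow_eq_zero_iff two_ne_zero |>.1 (le_antisymm h9 (sq_nonneg _)))

attribute [local instance] Matrix.frobeniusNormedRing Matrix.frobeniusNormedAlgebra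

/-- The squaring map has an analytic local right inverse near the square of a positive definite
matrix. -/
lemma exists_local_sqrt {S : Mat n} {c : ℝ} (hc : 0 < c)
    (hS : (S - c • (1 : Mat n)).PosSemidef) (hS' : S.PosSemidef) :
    ∃ R : Mat n → Mat n, R (S * S) = S ∧ ContDiffAt ℝ ω R (S * S) ∧
      ∀ᶠ B in 𝓝 (S * S), R B * R B = B := by
  have hcd : ContDiffAt ℝ ω (fun X : Mat n => X * X) S := contDiffAt_id.mul contDiffAt_id
  let L : Mat n →ₗ[ℝ] Mat n := LinearMap.mulLeft ℝ S + LinearMap.mulRight ℝ S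
  have hL : Function.Injective L := by
    rw [injective_iff_map_eq_zero]
    intro H hH
    exact sylvester_eq_zero hS (by simpa using hc) hS' hH
  let L' : Mat n ≃L[ℝ] Mat n := (LinearEquiv.ofInjectiveEndo L hL).toContinuousLinearEquiv
  have hd : HasFDerivAt (fun X : Mat n => X * X) (L' : Mat n →L[ℝ] Mat n) S := by
    convert! (hasFDerivAt_id (𝕜 := ℝ) S).mul' (hasFDerivAt_id S) using 1
  have hω : (ω : WithTop ℕ∞) ≠ 0 := by simp
  refine ⟨hcd.localInverse hd hω, hcd.localInverse_apply_image hd hω,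
    hcd.to_localInverse hd hω, ?_⟩
  exact (hcd.hasStrictFDerivAt' hd hω).eventually_right_inverse

/-- Near a symmetric matrix `A` without eigenvalue `δ`, the spectral projection onto the
eigenvalues greater than `δ` extends to an analytic map. -/
lemma exists_spectral_projection {A P : Mat n} {lam : Fin n → ℝ} (hA : IsEigDecomp A P lam)
    {δ : ℝ} (hδ : ∀ i, lam i ≠ δ) :
    ∃ E : Mat n → Mat n, ContDiffAt ℝ ω E A ∧ ∀ᶠ B in 𝓝 A, ∀ Q mu, IsEigDecomp B Q mu →
      E B = conjDiag Q (fun i => if δ < mu i then 1 else 0) := by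
  have hc : ∃ c > 0, ∀ i, c ≤ |lam i - δ| := by
    have : ∀ᶠ c in 𝓝[>] (0 : ℝ), ∀ i, c ≤ |lam i - δ| := eventually_all.2 fun i =>
      mem_nhdsWithin_of_mem_nhds <| Iic_mem_nhds <| abs_pos.2 <| sub_ne_zero.2 (hδ i)
    obtain ⟨c, h1, h2⟩ := (this.and self_mem_nhdsWithin).exists
    exact ⟨c, h2, h1⟩
  obtain ⟨c, hc0, hc⟩ := hc
  have habs : ∀ {B Q : Mat n} {mu : Fin n → ℝ}, IsEigDecomp B Q mu →
      conjDiag Q (fun i => |mu i - δ|) * conjDiag Q (fun i => |mu i - δ|) =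
        (B - δ • (1 : Mat n)) * (B - δ • (1 : Mat n)) := by
    intro B Q mu h
    rw [show B = conjDiag Q mu from h.2.2, conjDiag_sub_smul_one h.1, conjDiag_mul h.1,
      conjDiag_mul h.1]
    simp only [abs_mul_abs_self]
  set S := conjDiag P (fun i => |lam i - δ|) with hSdef
  have hS : (S - c • (1 : Mat n)).PosSemidef := by
    rw [hSdef, conjDiag_sub_smul_one hA.1]
    exact conjDiag_posSemidef P fun i => sub_nonneg.2 (hc i)
  obtain ⟨R, hRS, hR, hRR⟩ :=
    exists_local_sqrt hc0 hS (conjDiag_posSemidef P fun i => abs_nonneg _)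
  have hSu : IsUnit S :=
    (isUnit_conjDiag_iff hA.1).2 fun i => (hc0.trans_le (hc i)).ne'
  have hshift : ContDiff ℝ ω fun B : Mat n => B - δ • (1 : Mat n) := contDiff_id.sub contDiff_const
  have hsq : ContDiff ℝ ω fun B : Mat n => (B - δ • (1 : Mat n)) * (B - δ • (1 : Mat n)) :=
    hshift.mul hshift
  rw [habs hA] at hR hRR hRS
  let T : Mat n → Mat n := fun B => R ((B - δ • (1 : Mat n)) * (B - δ • (1 : Mat n)))
  have hTA : T A = S := hRS
  have hT : ContDiffAt ℝ ω T A := ContDiffAt.comp A hR hsq.contDiffAt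
  have hinv : ContDiffAt ℝ ω (fun B => Ring.inverse (T B)) A := by
    obtain ⟨u, hu⟩ := hSu
    have hu' : ContDiffAt ℝ ω (Ring.inverse : Mat n → Mat n) (T A) := by
      rw [hTA, ← hu]
      exact contDiffAt_ringInverse ℝ u
    exact hu'.comp A hT
  refine ⟨fun B => (1 / 2 : ℝ) • (1 + (B - δ • (1 : Mat n)) * Ring.inverse (T B)),
    (contDiffAt_const.add (hshift.contDiffAt.mul hinv)).const_smul _, ?_⟩
  have e1 : ∀ᶠ B in 𝓝 A, T B * T B = (B - δ • (1 : Mat n)) * (B - δ • (1 : Mat n)) :=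
    hsq.continuous.continuousAt.eventually hRR
  have e2 : ∀ᶠ B in 𝓝 A, ‖T B - S‖ < c := by
    have : Tendsto (fun B => ‖T B - S‖) (𝓝 A) (𝓝 0) := by
      have := (hT.continuousAt.sub (continuousAt_const (y := S))).norm
      rw [ContinuousAt, Pi.sub_apply, hTA, sub_self, norm_zero] at this
      exact this
    exact this.eventually (gt_mem_nhds hc0)
  have e3 : ∀ᶠ B in 𝓝 A, IsUnit (T B) :=
    hT.continuousAt.eventually (Units.isOpen.mem_nhds (by rw [hTA]; exact hSu))
  filter_upwards [e1, e2, e3] with B h1 h2 h3 Q mu hB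
  have hTB : T B = conjDiag Q (fun i => |mu i - δ|) := by
    set Y := conjDiag Q (fun i => |mu i - δ|) with hY
    refine sub_eq_zero.1 (sylvester_eq_zero hS h2
      (conjDiag_posSemidef Q fun i => abs_nonneg (mu i - δ)) ?_)
    rw [← hY, mul_sub, sub_mul, h1, habs hB, sub_add_sub_cancel, sub_self]
  have hmu : ∀ i, |mu i - δ| ≠ 0 := (isUnit_conjDiag_iff hB.1).1 (hTB ▸ h3)
  have hI : Ring.inverse (T B) = conjDiag Q (fun i => |mu i - δ|⁻¹) := by
    have hmul : conjDiag Q (fun i => |mu i - δ|⁻¹) * T B = 1 := by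
      rw [hTB, conjDiag_mul hB.1, ← conjDiag_one hB.1]
      congr 1; ext i; exact inv_mul_cancel₀ (hmu i)
    calc _ = conjDiag Q (fun i => |mu i - δ|⁻¹) * T B * Ring.inverse (T B) := by
          rw [hmul, one_mul]
      _ = _ := by rw [mul_assoc, Ring.mul_inverse_cancel _ h3, mul_one]
  rw [hI, show B - δ • (1 : Mat n) = conjDiag Q (fun i => mu i - δ) by
    rw [show B = conjDiag Q mu from hB.2.2, conjDiag_sub_smul_one hB.1],
    conjDiag_mul hB.1, ← conjDiag_one hB.1, conjDiag_add, conjDiag_smul]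
  congr 1; ext i
  have hi := abs_ne_zero.1 (hmu i)
  split_ifs with h
  · rw [abs_of_pos (sub_pos.2 h), mul_inv_cancel₀ hi]; norm_num
  · rw [abs_of_neg (lt_of_le_of_ne (sub_nonpos.2 (not_lt.1 h)) hi), inv_neg, mul_neg,
      mul_inv_cancel₀ hi]
    norm_num

/-- The number of positive entries equals the number of entries above `δ`, so no entry lies in
`(0, δ]`. -/
lemma lt_of_ncard_eq {mu : Fin n → ℝ} {δ : ℝ} (hδ : 0 < δ)
    (h : {i | δ < mu i}.ncard = {i | 0 < mu i}.ncard) {i : Fin n} (hi : 0 < mu i) : δ < mu i := by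
  have : {i | δ < mu i} = {i | 0 < mu i} :=
    Set.eq_of_subset_of_ncard_le (fun j hj => hδ.trans hj) h.ge
  exact this.ge hi

lemma sum_indicator_eq_ncard (mu : Fin n → ℝ) (δ : ℝ) :
    ∑ i, (if δ < mu i then (1 : ℝ) else 0) = ({i | δ < mu i}.ncard : ℝ) := by
  rw [Finset.sum_boole, Set.ncard_eq_toFinset_card']
  simp

lemma exists_analytic_extension {p q : ℕ} {A : Mat n} (hA : A ∈ stratum n p q) :
    ∃ Φ : Mat n → Mat n, ContDiffAt ℝ ω Φ A ∧
      ∀ᶠ B in 𝓝 A, B ∈ stratum n p q → Φ B = piPlus B := by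
  obtain ⟨P, lam, hP, hp, -⟩ := hA
  have hδ : ∃ δ > 0, ∀ i, 0 < lam i → δ < lam i := by
    have : ∀ᶠ δ in 𝓝[>] (0 : ℝ), ∀ i, 0 < lam i → δ < lam i := eventually_all.2 fun i =>
      eventually_imp_distrib_left.2 fun hi => mem_nhdsWithin_of_mem_nhds <| Iio_mem_nhds hi
    obtain ⟨δ, h1, h2⟩ := (this.and self_mem_nhdsWithin).exists
    exact ⟨δ, h2, h1⟩
  obtain ⟨δ, hδ0, hδ⟩ := hδ
  obtain ⟨E, hE, hEv⟩ := exists_spectral_projection hP (δ := δ) fun i h =>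
    (hδ i (h ▸ hδ0)).ne' h
  refine ⟨fun B => B * E B, contDiffAt_id.mul hE, ?_⟩
  have htrA : (E A).trace = p := by
    rw [hEv.self_of_nhds P lam hP, conjDiag_trace hP.1, sum_indicator_eq_ncard, ← hp]
    congr 2
    ext i
    exact ⟨fun h => hδ0.trans h, hδ i⟩
  have htr : ∀ᶠ B in 𝓝 A, |(E B).trace - p| < 1 := by
    have hcont : ContinuousAt (fun B => (E B).trace) A :=
      (continuous_id.matrix_trace).continuousAt.comp hE.continuousAt
    have h := (hcont.sub (continuousAt_const (y := (p : ℝ)))).abs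
    refine h.eventually (gt_mem_nhds ?_)
    simp [htrA]
  filter_upwards [hEv, htr] with B hB ht hBs
  obtain ⟨Q, mu, hQ, hp', -⟩ := hBs
  have hEB := hB Q mu hQ
  rw [hEB, conjDiag_trace hQ.1, sum_indicator_eq_ncard] at ht
  have hcard : {i | δ < mu i}.ncard = p := by
    have : |(({i | δ < mu i}.ncard : ℤ) - p)| < 1 := by exact_mod_cast ht
    rw [Int.abs_lt_one_iff] at this
    omega
  rw [hEB, piPlus_eq hQ]
  nth_rewrite 1 [show B = conjDiag Q mu from hQ.2.2]
  rw [conjDiag_mul hQ.1]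
  congr 1; ext i
  split_ifs with h
  · rw [mul_one, max_eq_left (hδ0.trans h).le]
  · rw [mul_zero, max_eq_right]
    by_contra! hi
    exact h (lt_of_ncard_eq hδ0 (hcard.trans hp'.symm) hi)

lemma piPlus_isSymm {A : Mat n} {p q : ℕ} (hA : A ∈ stratum n p q) : (piPlus A)ᵀ = piPlus A := by
  obtain ⟨P, lam, hP, -⟩ := hA
  rw [piPlus_eq hP, conjDiag_transpose]

end SpectralProjection

/-- For all `p, q ≥ 0` with `p + q ≤ n` and every `A ∈ M_{p,q}`, there are
an open neighborhood `U` of `A` and a `C^∞` map `Φ : U → Sⁿ` agreeing with `Π₊` on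
`U ∩ M_{p,q}`; in particular `Π₊` restricted to each stratum is `C^∞`. -/
theorem piPlus_smooth_on_stratum {n : ℕ} (p q : ℕ) (hpq : p + q ≤ n)
    (A : Mat n) (hA : A ∈ stratum n p q) :
    ∃ U : Set (Mat n), IsOpen U ∧ A ∈ U ∧
      ∃ Φ : Mat n → Mat n, ContDiffOn ℝ (⊤ : ℕ∞) Φ U ∧ (∀ A' ∈ U, (Φ A').IsSymm) ∧
        ∀ A' ∈ U ∩ stratum n p q, Φ A' = piPlus A' := by
  obtain ⟨Φ, hΦ, hv⟩ := exists_analytic_extension hA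
  obtain ⟨U, hU, hUo, hAU⟩ :=
    eventually_nhds_iff.1 ((hΦ.eventually (by simp)).and hv)
  have hT : ContDiff ℝ (⊤ : ℕ∞) fun B : Mat n => Bᵀ :=
    (Matrix.transposeLinearEquiv (Fin n) (Fin n) ℝ ℝ).toLinearMap.toContinuousLinearMap.contDiff
  refine ⟨U, hUo, hAU, fun B => (1 / 2 : ℝ) • (Φ B + (Φ B)ᵀ), ?_, ?_, ?_⟩
  · have h : ContDiffOn ℝ (⊤ : ℕ∞) Φ U := fun B hB =>
      ((hU B hB).1.of_le le_top).contDiffWithinAt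
    exact (h.add (hT.comp_contDiffOn h)).const_smul _
  · intro B _
    simp [Matrix.IsSymm, add_comm]
  · rintro B ⟨hB, hBs⟩
    change (1 / 2 : ℝ) • (Φ B + (Φ B)ᵀ) = piPlus B
    rw [(hU B hB).2 hBs, piPlus_isSymm hBs, ← two_smul ℝ, smul_smul]
    norm_num
end

section
/- Let z̄ be a KKT pair (F(z̄) = 0), and let p, q be the positive and negative inertia indices of G(z̄), so z̄ ∈ M̃_{p,q}. If the W-SOC and the W-SRCQ hold at z̄, then there exist a constant C > 0 and an open neighborhood U of z̄ in ℝ^m × S^n such that z̄ is the unique zero of F in M̃_{p,q} ∩ U and ‖F(z)‖ ≥ C·‖z − z̄‖ for every z ∈ M̃_{p,q} ∩ U (the stratum-restricted local error bound). -/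
open scoped Classical RealInnerProductSpace
open Matrix Set

namespace StratumErrorBound

open Filter Topology

/-- If matrices of rank at most the number of nonzero entries of `μ` converge to `diagonal μ` with
first order rate `U`, then the block of `U` indexed by the zeros of `μ` vanishes. -/
lemma eq_zero_of_rank_le_of_tendsto {n : ℕ} {N : ℕ → Mat n} {t : ℕ → ℝ} {μ : Fin n → ℝ} {U : Mat n}
    (hrank : ∀ k, (N k).rank ≤ Fintype.card {i // μ i ≠ 0})
    (hN : Tendsto N atTop (𝓝 (diagonal μ)))
    (hU : Tendsto (fun k => (t k)⁻¹ • (N k - diagonal μ)) atTop (𝓝 U))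
    {i j : Fin n} (hi : μ i = 0) (hj : μ j = 0) : U i j = 0 := by
  let r (a : Fin n) : {i // μ i ≠ 0} ⊕ Unit → Fin n := Sum.elim Subtype.val fun _ => a
  let L (k : ℕ) : Mat n := diagonal (fun a => if μ a = 0 then (t k)⁻¹ else 1) * N k
  let L' : Mat n := of fun a b => if μ a = 0 then U a b else diagonal μ a b
  have hL : Tendsto L atTop (𝓝 L') := by
    refine tendsto_pi_nhds.2 fun a => tendsto_pi_nhds.2 fun b => ?_
    have hNab := tendsto_pi_nhds.1 (tendsto_pi_nhds.1 hN a) b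
    have hUab := tendsto_pi_nhds.1 (tendsto_pi_nhds.1 hU a) b
    by_cases ha : μ a = 0
    · have hd : diagonal μ a b = 0 := by
        by_cases hab : a = b
        · subst hab; simp [ha]
        · simp [hab]
      simpa [L, L', ha, diagonal_mul, hd] using hUab
    · simpa [L, L', ha, diagonal_mul] using hNab
  have hdet : ∀ k, ((L k).submatrix (r i) (r j)).det = 0 := by
    intro k
    by_contra hne
    have h1 := rank_of_det_ne_zero hne
    have h2 := ((rank_submatrix_le (L k) (r i) (r j)).trans (rank_mul_le_right _ _)).trans (hrank k)
    rw [h1] at h2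
    simp at h2
  have hcont : Continuous fun M : Mat n => (M.submatrix (r i) (r j)).det :=
    (continuous_id.matrix_submatrix _ _).matrix_det
  have hlim : (L'.submatrix (r i) (r j)).det = 0 := by
    have h := (hcont.tendsto L').comp hL
    refine tendsto_nhds_unique h ?_
    simp [Function.comp_def, hdet]
  have hblock : L'.submatrix (r i) (r j) =
      fromBlocks (diagonal fun a : {i // μ i ≠ 0} => μ a) 0
        (of fun _ b => U i b) (of fun _ _ => U i j) := by
    ext a b
    rcases a with a | a <;> rcases b with b | b
    · by_cases hab : a = b
      · subst hab; simp [L', r, a.2]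
      · have : (a : Fin n) ≠ b := fun h => hab (Subtype.ext h)
        simp [L', r, a.2, hab, this]
    · have : (a : Fin n) ≠ j := fun h => a.2 (h ▸ hj)
      simp [L', r, a.2, this]
    · simp [L', r, hi]
    · simp [L', r, hi]
  rw [hblock, det_fromBlocks_zero₁₂, det_diagonal] at hlim
  simpa [Finset.prod_eq_zero_iff, imp_false, Subtype.prop] using hlim

lemma ncard_eq_of_isEigDecomp {n : ℕ} {A P P' : Mat n} {lam lam' : Fin n → ℝ}
    (h : IsEigDecomp A P lam) (h' : IsEigDecomp A P' lam') (s : Set ℝ) :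
    {i | lam i ∈ s}.ncard = {i | lam' i ∈ s}.ncard := by
  have key : ∀ {P : Mat n} {lam : Fin n → ℝ}, IsEigDecomp A P lam →
      A.charpoly.roots = Finset.univ.val.map lam := by
    intro P lam h
    rw [h.2.2, charpoly_mul_comm, ← mul_assoc, h.1.2, one_mul, charpoly_diagonal]
    rw [← Polynomial.roots_multiset_prod_X_sub_C (Finset.univ.val.map lam), Multiset.map_map]
    rfl
  have count : ∀ lam : Fin n → ℝ,
      {i | lam i ∈ s}.ncard = (Finset.univ.val.map lam).countP (· ∈ s) := by
    intro lam
    rw [Multiset.countP_map, Set.ncard_eq_toFinset_card']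
    simp [Finset.card_def, Finset.filter_val]
  rw [count, count, ← key h, ← key h']

lemma exists_piPlus_eq {n p q : ℕ} {A : Mat n} (hA : A ∈ stratum n p q) :
    ∃ P lam, IsEigDecomp A P lam ∧ piPlus A = P * diagonal (fun i => max (lam i) 0) * Pᵀ ∧
      {i | 0 < lam i}.ncard = p ∧ {i | lam i < 0}.ncard = q := by
  obtain ⟨P, lam, h, rfl, rfl⟩ := hA
  have hex : ∃ P lam, IsEigDecomp A P lam := ⟨P, lam, h⟩
  have h' := hex.choose_spec.choose_spec
  refine ⟨hex.choose, hex.choose_spec.choose, h', ?_, ?_, ?_⟩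
  · rw [piPlus, dif_pos hex]
  · exact ncard_eq_of_isEigDecomp h' h (Set.Ioi 0)
  · exact ncard_eq_of_isEigDecomp h' h (Set.Iio 0)

lemma rank_conj_diagonal_le {n : ℕ} (P : Mat n) (d : Fin n → ℝ) :
    (P * diagonal d * Pᵀ).rank ≤ {i | d i ≠ 0}.ncard := by
  refine (rank_mul_le_left _ _).trans ((rank_mul_le_right _ _).trans ?_)
  rw [rank_diagonal, Set.ncard_eq_toFinset_card', Set.toFinset_card]
  exact (Fintype.card_congr (Equiv.refl _)).le

lemma max_ne_zero_iff {x : ℝ} : max x 0 ≠ 0 ↔ 0 < x := by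
  rcases le_or_gt x 0 with h | h
  · simp [h]
  · simp [h.le, h, h.ne']

lemma min_ne_zero_iff {x : ℝ} : min x 0 ≠ 0 ↔ x < 0 := by
  rcases le_or_gt 0 x with h | h
  · simp [h]
  · simp [h.le, h, h.ne]

lemma sub_piPlus_eq {n : ℕ} {A P : Mat n} {lam : Fin n → ℝ} (h : IsEigDecomp A P lam)
    (hp : piPlus A = P * diagonal (fun i => max (lam i) 0) * Pᵀ) :
    A - piPlus A = P * diagonal (fun i => min (lam i) 0) * Pᵀ := by
  have hd : diagonal (fun i => min (lam i) 0) =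
      diagonal lam - diagonal (fun i => max (lam i) 0) := by
    rw [diagonal_sub]
    congr 1
    funext i
    linarith [min_add_max (lam i) 0]
  rw [hp, hd, mul_sub, sub_mul, ← h.2.2]

lemma piPlus_mul_sub_eq_zero {n p q : ℕ} {A : Mat n} (hA : A ∈ stratum n p q) :
    piPlus A * (A - piPlus A) = 0 := by
  obtain ⟨P, lam, h, hp, -, -⟩ := exists_piPlus_eq hA
  rw [sub_piPlus_eq h hp, hp]
  have : P * diagonal (fun i => max (lam i) 0) * Pᵀ * (P * diagonal (fun i => min (lam i) 0) * Pᵀ) =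
      P * (diagonal (fun i => max (lam i) 0) * (Pᵀ * P) * diagonal (fun i => min (lam i) 0)) * Pᵀ := by
    simp only [mul_assoc]
  rw [this, h.1.2, mul_one, diagonal_mul_diagonal]
  have h0 : (fun i => max (lam i) 0 * min (lam i) 0) = 0 := by
    funext i
    rw [max_mul_min, mul_zero, Pi.zero_apply]
  rw [h0]
  simp

lemma rank_piPlus_le {n p q : ℕ} {A : Mat n} (hA : A ∈ stratum n p q) : (piPlus A).rank ≤ p := by
  obtain ⟨P, lam, h, hp, rfl, -⟩ := exists_piPlus_eq hA
  rw [hp]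
  simpa only [max_ne_zero_iff] using rank_conj_diagonal_le P fun i => max (lam i) 0

lemma rank_sub_piPlus_le {n p q : ℕ} {A : Mat n} (hA : A ∈ stratum n p q) :
    (A - piPlus A).rank ≤ q := by
  obtain ⟨P, lam, h, hp, -, rfl⟩ := exists_piPlus_eq hA
  rw [sub_piPlus_eq h hp]
  simpa only [min_ne_zero_iff] using rank_conj_diagonal_le P fun i => min (lam i) 0

lemma isClosed_isSymm (n : ℕ) : IsClosed {A : Mat n | A.IsSymm} :=
  isClosed_eq continuous_id.matrix_transpose continuous_id

lemma fderiv_isSymm {m n : ℕ} {g : Em m → Mat n} (hgs : ∀ x, (g x).IsSymm) {x : Em m}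
    (hg : DifferentiableAt ℝ g x) (v : Em m) : (fderiv ℝ g x v).IsSymm :=
  (isClosed_isSymm n).mem_of_tendsto (hg.hasFDerivAt.lim_real v)
    (Eventually.of_forall fun _ => ((hgs _).sub (hgs _)).smul _)

lemma inner_gradg {m n : ℕ} (g : Em m → Mat n) (x : Em m) (H : Mat n) (v : Em m) :
    ⟪gradg g x H, v⟫ = minner H (fderiv ℝ g x v) := by
  have hv : v = ∑ k, v k • EuclideanSpace.single k (1 : ℝ) := by
    ext i
    simp [Finset.sum_apply, Pi.single_apply]
  conv_rhs => rw [hv]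
  simp [minner, gradg, PiLp.inner_apply, map_sum, Matrix.mul_sum, trace_sum]

lemma hasGradientAt_Lfun {m n : ℕ} {f : Em m → ℝ} {g : Em m → Mat n} {x : Em m}
    (hf : DifferentiableAt ℝ f x) (hg : DifferentiableAt ℝ g x) (y : Mat n) :
    HasGradientAt (fun w => Lfun f g w y) (gradient f x + gradg g x y) x := by
  let T : Mat n →L[ℝ] ℝ :=
    LinearMap.toContinuousLinearMap ((traceLinearMap (Fin n) ℝ ℝ).comp (LinearMap.mulLeft ℝ yᵀ))
  have h := hf.hasFDerivAt.add (T.hasFDerivAt.comp x hg.hasFDerivAt)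
  rw [hasGradientAt_iff_hasFDerivAt]
  refine h.congr_fderiv ?_
  ext v
  simp only [_root_.add_apply, map_add, InnerProductSpace.toDual_apply_apply,
    inner_gradg, toDual_gradient]
  rfl

lemma hasFDerivAt_gradient_Lfun {m n : ℕ} {f : Em m → ℝ} {g : Em m → Mat n}
    (hf : ContDiff ℝ 2 f) (hg : ContDiff ℝ 2 g) (x : Em m) (y : Mat n) :
    HasFDerivAt (fun u => gradient (fun w => Lfun f g w y) u) (hessL f g x y) x := by
  let T : Mat n →L[ℝ] ℝ :=
    LinearMap.toContinuousLinearMap ((traceLinearMap (Fin n) ℝ ℝ).comp (LinearMap.mulLeft ℝ yᵀ))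
  have hL : ContDiff ℝ 2 fun w => Lfun f g w y := hf.add (T.contDiff.comp hg)
  have hd : Differentiable ℝ (fderiv ℝ fun w => Lfun f g w y) :=
    (hL.fderiv_right (m := 1) (by norm_num)).differentiable one_ne_zero
  have : DifferentiableAt ℝ (fun u => gradient (fun w => Lfun f g w y) u) x :=
    (InnerProductSpace.toDual ℝ (Em m)).symm.toContinuousLinearEquiv.differentiableAt.comp x (hd x)
  exact this.hasFDerivAt

lemma tendsto_trace_transpose_mul {n : ℕ} {H D : ℕ → Mat n} {A B : Mat n}
    (hH : Tendsto H atTop (𝓝 A)) (hD : Tendsto D atTop (𝓝 B)) :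
    Tendsto (fun k => ((H k)ᵀ * D k).trace) atTop (𝓝 (Aᵀ * B).trace) := by
  simp only [trace, Matrix.diag, mul_apply, transpose_apply]
  exact tendsto_finsetSum _ fun i _ => tendsto_finsetSum _ fun j _ =>
    (tendsto_pi_nhds.1 (tendsto_pi_nhds.1 hH j) i).mul
      (tendsto_pi_nhds.1 (tendsto_pi_nhds.1 hD j) i)

lemma tendsto_gradg {m n : ℕ} {g : Em m → Mat n} (hg : ContDiff ℝ 2 g) {x : ℕ → Em m} {a : Em m}
    {H : ℕ → Mat n} {B : Mat n} (hx : Tendsto x atTop (𝓝 a)) (hH : Tendsto H atTop (𝓝 B)) :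
    Tendsto (fun k => gradg g (x k) (H k)) atTop (𝓝 (gradg g a B)) := by
  have hderiv : ∀ v, Tendsto (fun k => fderiv ℝ g (x k) v) atTop (𝓝 (fderiv ℝ g a v)) := fun v =>
    (((hg.continuous_fderiv two_ne_zero).clm_apply continuous_const).tendsto a).comp hx
  exact ((EuclideanSpace.equiv (Fin m) ℝ).symm.continuous.tendsto _).comp
    (tendsto_pi_nhds.2 fun i => tendsto_trace_transpose_mul hH (hderiv _))

lemma minner_eq_sum {n : ℕ} (A B : Mat n) : minner A B = ∑ i, ∑ j, A i j * B i j := by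
  rw [minner, trace, Finset.sum_comm]
  simp [mul_apply]

lemma minner_conj {n : ℕ} {P : Mat n} (hP : IsOrthoMat P) (A B : Mat n) :
    minner (Pᵀ * A * P) (Pᵀ * B * P) = minner A B := by
  have h : (Pᵀ * A * P)ᵀ * (Pᵀ * B * P) = Pᵀ * (Aᵀ * (P * Pᵀ) * B * P) := by
    simp only [transpose_mul, transpose_transpose, mul_assoc]
  rw [minner, h, trace_mul_comm, hP.1, mul_one]
  simp only [mul_assoc, hP.1, mul_one, minner]

lemma gradg_add {m n : ℕ} (g : Em m → Mat n) (x : Em m) (A B : Mat n) :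
    gradg g x (A + B) = gradg g x A + gradg g x B := by
  ext i
  simp [gradg, add_mul]

lemma gradg_smul {m n : ℕ} (g : Em m → Mat n) (x : Em m) (c : ℝ) (A : Mat n) :
    gradg g x (c • A) = c • gradg g x A := by
  ext i
  simp [gradg]

/-- The linearized KKT system has only the trivial solution under W-SOC and W-SRCQ. -/
lemma eq_zero_of_linearized_KKT {m n : ℕ} {f : Em m → ℝ} {g : Em m → Mat n} {z : Em m × Mat n}
    {P : Mat n} {lam : Fin n → ℝ} (hP : IsEigDecomp (Gmap g z) P lam)
    (hW : WSOC f g z) (hS : WSRCQ g z) {v : Em m} {W : Mat n} (hWs : W.IsSymm)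
    (hUs : (fderiv ℝ g z.1 v).IsSymm)
    (hcomp : (Pᵀ * fderiv ℝ g z.1 v * P) * diagonal (fun i => min (lam i) 0) +
      diagonal (fun i => max (lam i) 0) * (Pᵀ * W * P) = 0)
    (hU0 : ∀ i j, lam i = 0 → lam j = 0 → (Pᵀ * fderiv ℝ g z.1 v * P) i j = 0)
    (hW0 : ∀ i j, lam i = 0 → lam j = 0 → (Pᵀ * W * P) i j = 0)
    (hgrad : hessL f g z.1 z.2 v + gradg g z.1 W = 0) : v = 0 ∧ W = 0 := by
  have symm_conj : ∀ {A : Mat n}, A.IsSymm → ∀ i j, (Pᵀ * A * P) i j = (Pᵀ * A * P) j i := by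
    intro A hA i j
    refine IsSymm.apply ?_ j i
    rw [IsSymm, transpose_mul, transpose_mul, hA.eq, transpose_transpose, mul_assoc]
  have hWsymm := symm_conj hWs
  have hUsymm := symm_conj hUs
  have hconj : ∀ A B, minner (Pᵀ * A * P) (Pᵀ * B * P) = minner A B := minner_conj hP.1
  have hentry : ∀ i j, (Pᵀ * fderiv ℝ g z.1 v * P) i j * min (lam j) 0 +
      max (lam i) 0 * (Pᵀ * W * P) i j = 0 := by
    intro i j
    have := congrFun (congrFun hcomp i) j
    rwa [Matrix.add_apply, mul_diagonal, diagonal_mul] at this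
  have hUneg : ∀ i j, lam i ≤ 0 → lam j < 0 → (Pᵀ * fderiv ℝ g z.1 v * P) i j = 0 := by
    intro i j hi hj
    have h := hentry i j
    rw [max_eq_right hi, min_eq_left hj.le, zero_mul, add_zero] at h
    exact (mul_eq_zero.1 h).resolve_right hj.ne
  have hWpos : ∀ i j, 0 < lam i → 0 ≤ lam j → (Pᵀ * W * P) i j = 0 := by
    intro i j hi hj
    have h := hentry i j
    rw [max_eq_left hi.le, min_eq_right hj, mul_zero, zero_add] at h
    exact (mul_eq_zero.1 h).resolve_left hi.ne'
  have hWU : ∀ i j, 0 < lam i → lam j < 0 →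
      (Pᵀ * W * P) i j = -lam j / lam i * (Pᵀ * fderiv ℝ g z.1 v * P) i j := by
    intro i j hi hj
    have h := hentry i j
    rw [max_eq_left hi.le, min_eq_left hj.le] at h
    field_simp
    linarith
  have hv : v = 0 := by
    by_contra hv
    refine hW P lam hP v hv ⟨hU0, fun i j hi => hUneg i j hi.le, fun i j hi => hUneg i j hi.le⟩ ?_
    have hinner : ⟪v, hessL f g z.1 z.2 v⟫ = -minner W (fderiv ℝ g z.1 v) := by
      rw [eq_neg_of_add_eq_zero_left hgrad, inner_neg_right, real_inner_comm, inner_gradg]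
    rw [Qform, hinner, ← hconj, minner_eq_sum]
    generalize Pᵀ * fderiv ℝ g z.1 v * P = U' at *
    generalize Pᵀ * W * P = W' at *
    have hpt : ∀ i j, W' i j * U' i j =
        (if 0 < lam i ∧ lam j < 0 then -lam j / lam i * U' i j ^ 2 else 0) +
        (if 0 < lam j ∧ lam i < 0 then -lam i / lam j * U' j i ^ 2 else 0) := by
      intro i j
      rcases lt_trichotomy (lam i) 0 with hi | hi | hi <;>
        rcases lt_trichotomy (lam j) 0 with hj | hj | hj
      · simp [hUneg i j hi.le hj, hi.not_gt, hj.not_gt]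
      · simp [hUsymm i j, hUneg j i hj.le hi, hi.not_gt, hj]
      · simp only [hi.not_gt, hi, hj, hj.not_gt, and_self, if_true, if_false, zero_add]
        rw [hWsymm i j, hUsymm i j, hWU j i hj hi]
        ring
      · simp [hUneg i j hi.le hj, hi, hj.not_gt]
      · simp [hW0 i j hi hj, hi, hj]
      · simp [hWsymm i j, hWpos j i hj hi.ge, hi, hj.not_gt]
      · simp only [hi.not_gt, hi, hj, hj.not_gt, and_self, if_true, if_false, add_zero]
        rw [hWU i j hi hj]
        ring
      · simp [hWpos i j hi hj.ge, hi.not_gt, hj]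
      · simp [hWpos i j hi hj.le, hi.not_gt, hj.not_gt]
    simp only [hpt, Finset.sum_add_distrib]
    rw [Finset.sum_comm (f := fun i j =>
      if 0 < lam j ∧ lam i < 0 then -lam i / lam j * U' j i ^ 2 else 0)]
    ring
  refine ⟨hv, ?_⟩
  have hWneg : ∀ i j, 0 < lam i → (Pᵀ * W * P) i j = 0 := by
    intro i j hi
    rcases lt_or_ge (lam j) 0 with hj | hj
    · rw [hWU i j hi hj, hv]
      simp
    · exact hWpos i j hi hj
  have hgradW : gradg g z.1 W = 0 := by simpa [hv] using hgrad
  obtain ⟨u, B, hBs, hB0, hBneg, hC⟩ := hS P lam hP W hWs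
  have hWW : minner W W = 0 := by
    have h1 : minner W W = minner W (fderiv ℝ g z.1 u) + minner W (P * B * Pᵀ) := by
      conv_lhs => arg 2; rw [hC]
      rw [minner, mul_add, trace_add, minner, minner]
    have h2 : Pᵀ * (P * B * Pᵀ) * P = B := by
      have : Pᵀ * (P * B * Pᵀ) * P = (Pᵀ * P) * B * (Pᵀ * P) := by simp only [mul_assoc]
      rw [this, hP.1.2, one_mul, mul_one]
    rw [h1, ← inner_gradg, hgradW, inner_zero_left, zero_add, ← hconj, h2, minner_eq_sum]
    refine Finset.sum_eq_zero fun i _ => Finset.sum_eq_zero fun j _ => ?_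
    rcases lt_trichotomy (lam i) 0 with hi | hi | hi
    · rcases lt_trichotomy (lam j) 0 with hj | hj | hj
      · rw [hBneg i j hi hj, mul_zero]
      · rw [← hBs.apply, hB0 j i hj hi, mul_zero]
      · rw [hWsymm, hWneg j i hj, zero_mul]
    · rcases lt_trichotomy (lam j) 0 with hj | hj | hj
      · rw [hB0 i j hi hj, mul_zero]
      · rw [hW0 i j hi hj, zero_mul]
      · rw [hWsymm, hWneg j i hj, zero_mul]
    · rw [hWneg i j hi, zero_mul]
  rw [minner_eq_sum] at hWW
  ext i j
  have hi := (Finset.sum_eq_zero_iff_of_nonneg fun i _ =>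
    Finset.sum_nonneg fun j _ => mul_self_nonneg (W i j)).1 hWW i (Finset.mem_univ i)
  have hj := (Finset.sum_eq_zero_iff_of_nonneg fun j _ =>
    mul_self_nonneg (W i j)).1 hi j (Finset.mem_univ j)
  exact mul_self_eq_zero.1 hj

lemma tendsto_of_tendsto_inv_smul_sub {E : Type*} [NormedAddCommGroup E] [NormedSpace ℝ E]
    {a : ℕ → E} {b c : E} {t : ℕ → ℝ} (ht : ∀ k, t k ≠ 0) (ht0 : Tendsto t atTop (𝓝 0))
    (h : Tendsto (fun k => (t k)⁻¹ • (a k - b)) atTop (𝓝 c)) : Tendsto a atTop (𝓝 b) := by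
  have := (ht0.smul h).add_const b
  simpa [smul_smul, ht] using this

lemma HasFDerivAt.tendsto_inv_smul {E F : Type*} [NormedAddCommGroup E] [NormedSpace ℝ E]
    [NormedAddCommGroup F] [NormedSpace ℝ F] {h : E → F} {h' : E →L[ℝ] F} {a v : E} {x : ℕ → E}
    {t : ℕ → ℝ} (hh : HasFDerivAt h h' a) (ht : ∀ k, t k ≠ 0) (ht0 : Tendsto t atTop (𝓝 0))
    (hx : Tendsto (fun k => (t k)⁻¹ • (x k - a)) atTop (𝓝 v)) :
    Tendsto (fun k => (t k)⁻¹ • (h (x k) - h a)) atTop (𝓝 (h' v)) := by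
  have hd : Tendsto (fun k => x k - a) atTop (𝓝 0) := by
    simpa using (tendsto_of_tendsto_inv_smul_sub ht ht0 hx).sub_const a
  simpa using hh.hasFDerivWithinAt.lim (s := univ) hd (by simp) hx

lemma tendsto_conj {n : ℕ} (P : Mat n) {X : ℕ → Mat n} {D L : Mat n} {t : ℕ → ℝ}
    (hP : IsOrthoMat P)
    (h : Tendsto (fun k => (t k)⁻¹ • (X k - P * D * Pᵀ)) atTop (𝓝 L)) :
    Tendsto (fun k => (t k)⁻¹ • (Pᵀ * X k * P - D)) atTop (𝓝 (Pᵀ * L * P)) := by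
  have hc : Continuous fun M : Mat n => Pᵀ * M * P :=
    (continuous_const.matrix_mul continuous_id).matrix_mul continuous_const
  have hD : Pᵀ * (P * D * Pᵀ) * P = D := by
    have : Pᵀ * (P * D * Pᵀ) * P = (Pᵀ * P) * D * (Pᵀ * P) := by simp only [mul_assoc]
    rw [this, hP.2, one_mul, mul_one]
  refine ((hc.tendsto L).comp h).congr fun k => ?_
  simp only [Function.comp_apply, Matrix.mul_smul, Matrix.smul_mul, mul_sub, sub_mul, hD]

/-- A normalized limit direction of points of the stratum along which `F` vanishes to first order
is zero. -/
lemma limit_direction_eq_zero {m n p q : ℕ} {f : Em m → ℝ} {g : Em m → Mat n}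
    (hf : ContDiff ℝ 2 f) (hg : ContDiff ℝ 2 g) (hgs : ∀ x, (g x).IsSymm)
    {zbar : Em m × Mat n} (hkkt : KKTF f g zbar = 0) (hz : zbar ∈ lstratum g p q)
    (hW : WSOC f g zbar) (hS : WSRCQ g zbar)
    {z : ℕ → Em m × Mat n} {t : ℕ → ℝ} {w : Em m × Mat n} (hzk : ∀ k, z k ∈ lstratum g p q)
    (ht : ∀ k, t k ≠ 0) (ht0 : Tendsto t atTop (𝓝 0))
    (hw : Tendsto (fun k => (t k)⁻¹ • (z k - zbar)) atTop (𝓝 w))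
    (hF : Tendsto (fun k => (t k)⁻¹ • KKTF f g (z k)) atTop (𝓝 0)) : w = 0 := by
  obtain ⟨P, lam, hP, hpi, hp, hq⟩ := exists_piPlus_eq hz.2
  have hw1 : Tendsto (fun k => (t k)⁻¹ • ((z k).1 - zbar.1)) atTop (𝓝 w.1) :=
    (continuous_fst.tendsto w).comp hw
  have hw2 : Tendsto (fun k => (t k)⁻¹ • ((z k).2 - zbar.2)) atTop (𝓝 w.2) :=
    (continuous_snd.tendsto w).comp hw
  have hF1 : Tendsto (fun k => (t k)⁻¹ • (KKTF f g (z k)).1) atTop (𝓝 0) :=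
    (continuous_fst.tendsto (0 : Em m × Mat n)).comp hF
  have hF2 : Tendsto (fun k => (t k)⁻¹ • (KKTF f g (z k)).2) atTop (𝓝 0) :=
    (continuous_snd.tendsto (0 : Em m × Mat n)).comp hF
  have hdg : Differentiable ℝ g := hg.differentiable two_ne_zero
  have hdf : Differentiable ℝ f := hf.differentiable two_ne_zero
  have hglim := HasFDerivAt.tendsto_inv_smul (hdg zbar.1).hasFDerivAt ht ht0 hw1
  have hk2 : -g zbar.1 + piPlus (Gmap g zbar) = 0 := congrArg Prod.snd hkkt
  have hgbar : g zbar.1 = P * diagonal (fun i => max (lam i) 0) * Pᵀ := by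
    rw [← hpi]
    exact neg_add_eq_zero.1 hk2
  have hybar : zbar.2 = P * diagonal (fun i => min (lam i) 0) * Pᵀ := by
    rw [← sub_piPlus_eq hP hpi, ← neg_add_eq_zero.1 hk2, Gmap, add_sub_cancel_left]
  have hX : Tendsto (fun k => (t k)⁻¹ • (piPlus (Gmap g (z k)) -
      P * diagonal (fun i => max (lam i) 0) * Pᵀ)) atTop (𝓝 (fderiv ℝ g zbar.1 w.1)) := by
    have h := hF2.add hglim
    rw [zero_add] at h
    refine h.congr fun k => ?_
    rw [← hgbar, ← smul_add]
    congr 1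
    change -g (z k).1 + piPlus (Gmap g (z k)) + (g (z k).1 - g zbar.1) = _
    abel
  have hY : Tendsto (fun k => (t k)⁻¹ • (Gmap g (z k) - piPlus (Gmap g (z k)) -
      P * diagonal (fun i => min (lam i) 0) * Pᵀ)) atTop (𝓝 w.2) := by
    have h := hw2.sub hF2
    rw [sub_zero] at h
    refine h.congr fun k => ?_
    rw [← hybar, ← smul_sub, KKTF]
    congr 1
    simp only [Gmap]
    abel
  have hN := tendsto_conj P hP.1 hX
  have hM := tendsto_conj P hP.1 hY
  have hN0 := tendsto_of_tendsto_inv_smul_sub ht ht0 hN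
  have hM0 := tendsto_of_tendsto_inv_smul_sub ht ht0 hM
  have hcomp : (Pᵀ * fderiv ℝ g zbar.1 w.1 * P) * diagonal (fun i => min (lam i) 0) +
      diagonal (fun i => max (lam i) 0) * (Pᵀ * w.2 * P) = 0 := by
    have hmul : Continuous fun A : Mat n × Mat n => A.1 * A.2 :=
      continuous_fst.matrix_mul continuous_snd
    have h1 := (hmul.tendsto (_, _)).comp (hN.prodMk_nhds hM0)
    have h2 := (hmul.tendsto (_, _)).comp
      ((tendsto_const_nhds (x := diagonal fun i => max (lam i) 0)).prodMk_nhds hM)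
    refine tendsto_nhds_unique (h1.add h2) (tendsto_const_nhds.congr fun k => ?_)
    have hprod : (Pᵀ * piPlus (Gmap g (z k)) * P) *
        (Pᵀ * (Gmap g (z k) - piPlus (Gmap g (z k))) * P) = 0 := by
      have : (Pᵀ * piPlus (Gmap g (z k)) * P) *
          (Pᵀ * (Gmap g (z k) - piPlus (Gmap g (z k))) * P) =
          Pᵀ * (piPlus (Gmap g (z k)) * (P * Pᵀ) *
            (Gmap g (z k) - piPlus (Gmap g (z k)))) * P := by
        simp only [mul_assoc]
      rw [this, hP.1.1, mul_one, piPlus_mul_sub_eq_zero (hzk k).2, mul_zero, zero_mul]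
    have hdiag : (diagonal fun i => max (lam i) 0) * (diagonal fun i => min (lam i) 0) =
        (0 : Mat n) := by
      rw [diagonal_mul_diagonal, diagonal_eq_zero]
      funext i
      rw [max_mul_min, mul_zero, Pi.zero_apply]
    simp only [Function.comp_apply]
    generalize Pᵀ * (Gmap g (z k) - piPlus (Gmap g (z k))) * P = M at hprod ⊢
    rw [Matrix.smul_mul, Matrix.mul_smul, mul_sub, sub_mul, hprod, hdiag, ← smul_add]
    simp
  have hcard : ∀ {s : Fin n → Prop} {d : Fin n → ℝ} {r : ℕ}, (∀ i, d i ≠ 0 ↔ s i) →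
      {i | s i}.ncard = r → r = Fintype.card {i // d i ≠ 0} := by
    rintro s d _ hs rfl
    simp only [← hs]
    rw [Set.ncard_eq_toFinset_card', Set.toFinset_card]
    exact Fintype.card_congr (Equiv.refl _)
  have hrank : ∀ A : Mat n, (Pᵀ * A * P).rank ≤ A.rank := fun A =>
    (rank_mul_le_left _ _).trans (rank_mul_le_right _ _)
  have hgrad : hessL f g zbar.1 zbar.2 w.1 + gradg g zbar.1 w.2 = 0 := by
    have hgradL : ∀ u y, gradient (fun x => Lfun f g x y) u = gradient f u + gradg g u y :=
      fun u y => (hasGradientAt_Lfun (hdf u) (hdg u) y).gradient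
    have h1 := HasFDerivAt.tendsto_inv_smul
      (hasFDerivAt_gradient_Lfun hf hg zbar.1 zbar.2) ht ht0 hw1
    have h2 := tendsto_gradg hg (tendsto_of_tendsto_inv_smul_sub ht ht0 hw1) hw2
    refine tendsto_nhds_unique (h1.add h2) (hF1.congr fun k => ?_)
    have hk1 : gradient f zbar.1 + gradg g zbar.1 zbar.2 = 0 := congrArg Prod.fst hkkt
    have hy : (z k).2 = zbar.2 + ((z k).2 - zbar.2) := by abel
    rw [hgradL, hgradL, hk1, sub_zero, gradg_smul, ← smul_add, add_assoc, ← gradg_add, ← hy, KKTF]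
  obtain ⟨h1, h2⟩ := eq_zero_of_linearized_KKT hP hW hS
    ((isClosed_isSymm n).mem_of_tendsto hw2
      (Eventually.of_forall fun k => ((hzk k).1.sub hz.1).smul _))
    (fderiv_isSymm hgs (hdg _) _) hcomp
    (fun i j hi hj => eq_zero_of_rank_le_of_tendsto
      (fun k => ((hrank _).trans (rank_piPlus_le (hzk k).2)).trans
        (hcard (fun i => max_ne_zero_iff) hp).le) hN0 hN (by simp [hi]) (by simp [hj]))
    (fun i j hi hj => eq_zero_of_rank_le_of_tendsto
      (fun k => ((hrank _).trans (rank_sub_piPlus_le (hzk k).2)).trans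
        (hcard (fun i => min_ne_zero_iff) hq).le) hM0 hM (by simp [hi]) (by simp [hj]))
    hgrad
  exact Prod.ext h1 h2

lemma norm_le_pnorm {m n : ℕ} (w : Em m × Mat n) : ‖w‖ ≤ pnorm w := by
  refine max_le ?_ ?_ <;> refine Real.le_sqrt_of_sq_le ?_
  · exact le_add_of_nonneg_right (sq_nonneg _)
  · exact le_add_of_nonneg_left (sq_nonneg _)

lemma pnorm_le_two_mul_norm {m n : ℕ} (w : Em m × Mat n) : pnorm w ≤ 2 * ‖w‖ := by
  refine Real.sqrt_le_iff.2 ⟨by positivity, ?_⟩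
  have h1 := pow_le_pow_left₀ (norm_nonneg _) (norm_fst_le w) 2
  have h2 := pow_le_pow_left₀ (norm_nonneg _) (norm_snd_le w) 2
  nlinarith [sq_nonneg ‖w‖]

lemma eventually_error_bound {m n p q : ℕ} {f : Em m → ℝ} {g : Em m → Mat n}
    (hf : ContDiff ℝ 2 f) (hg : ContDiff ℝ 2 g) (hgs : ∀ x, (g x).IsSymm)
    {zbar : Em m × Mat n} (hkkt : KKTF f g zbar = 0) (hz : zbar ∈ lstratum g p q)
    (hW : WSOC f g zbar) (hS : WSRCQ g zbar) :
    ∃ C : ℝ, 0 < C ∧ ∀ᶠ z in 𝓝 zbar, z ∈ lstratum g p q →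
      C * pnorm (z - zbar) ≤ pnorm (KKTF f g z) := by
  by_contra! hcon
  have hex : ∀ k : ℕ, ∃ z, dist z zbar < 1 / ((k : ℝ) + 1) ∧ z ∈ lstratum g p q ∧
      pnorm (KKTF f g z) < 1 / ((k : ℝ) + 1) * pnorm (z - zbar) := by
    intro k
    have hk : (0 : ℝ) < 1 / ((k : ℝ) + 1) := Nat.one_div_pos_of_nat
    obtain ⟨z, ⟨h1, h2⟩, h3⟩ :=
      ((hcon _ hk).and_eventually (Metric.ball_mem_nhds zbar hk)).exists
    exact ⟨z, h3, h1, h2⟩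
  choose z hdist hmem hlt using hex
  have hpos : ∀ k, 0 < ‖z k - zbar‖ := by
    intro k
    refine norm_pos_iff.2 fun h0 => ?_
    have h := hlt k
    rw [h0] at h
    simp only [pnorm, Prod.fst_zero, Prod.snd_zero, norm_zero] at h
    norm_num at h
    exact h.not_ge (Real.sqrt_nonneg _)
  have ht0 : Tendsto (fun k => ‖z k - zbar‖) atTop (𝓝 0) :=
    squeeze_zero (fun _ => norm_nonneg _) (fun k => by
      rw [← dist_eq_norm]
      exact (hdist k).le) tendsto_one_div_add_atTop_nhds_zero_nat
  have hFlim : Tendsto (fun k => ‖z k - zbar‖⁻¹ • KKTF f g (z k)) atTop (𝓝 0) := by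
    have hlim : Tendsto (fun k : ℕ => 1 / ((k : ℝ) + 1) * 2) atTop (𝓝 0) := by
      simpa using (tendsto_one_div_add_atTop_nhds_zero_nat (𝕜 := ℝ)).mul_const 2
    refine squeeze_zero_norm (fun k => ?_) hlim
    rw [norm_smul, norm_inv, norm_norm, inv_mul_le_iff₀ (hpos k)]
    calc ‖KKTF f g (z k)‖ ≤ 1 / ((k : ℝ) + 1) * pnorm (z k - zbar) :=
          (norm_le_pnorm _).trans (hlt k).le
      _ ≤ 1 / ((k : ℝ) + 1) * (2 * ‖z k - zbar‖) :=
          mul_le_mul_of_nonneg_left (pnorm_le_two_mul_norm _) Nat.one_div_pos_of_nat.le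
      _ = ‖z k - zbar‖ * (1 / ((k : ℝ) + 1) * 2) := by ring
  have hsphere : ∀ k, ‖z k - zbar‖⁻¹ • (z k - zbar) ∈ Metric.sphere (0 : Em m × Mat n) 1 := by
    intro k
    rw [mem_sphere_zero_iff_norm, norm_smul, norm_inv, norm_norm, inv_mul_cancel₀ (hpos k).ne']
  obtain ⟨w, hw, φ, hφ, hlim⟩ :=
    (isCompact_sphere (0 : Em m × Mat n) 1).tendsto_subseq hsphere
  have hw0 : w = 0 := limit_direction_eq_zero hf hg hgs hkkt hz hW hS (z := z ∘ φ)
    (t := fun k => ‖z (φ k) - zbar‖) (fun k => hmem _) (fun k => (hpos _).ne')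
    (ht0.comp hφ.tendsto_atTop) hlim (hFlim.comp hφ.tendsto_atTop)
  rw [mem_sphere_zero_iff_norm, hw0, norm_zero] at hw
  exact zero_ne_one hw

end StratumErrorBound

/-- (Stratum-restricted local error bound.) If `z̄` is a KKT pair in
`M̃_{p,q}` at which the W-SOC and the W-SRCQ hold, then there are `C > 0` and an open
neighborhood `U` of `z̄` such that `z̄` is the unique zero of `F` in `M̃_{p,q} ∩ U` and
`‖F(z)‖ ≥ C‖z − z̄‖` for every `z ∈ M̃_{p,q} ∩ U`. -/
theorem stratum_restricted_local_error_bound {m n p q : ℕ}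
    (f : Em m → ℝ) (g : Em m → Mat n)
    (hf : ContDiff ℝ 2 f) (hg : ContDiff ℝ 2 g) (hgs : ∀ x, (g x).IsSymm)
    (zbar : Em m × Mat n)
    (hkkt : KKTF f g zbar = 0)
    (hz : zbar ∈ lstratum g p q)
    (hW : WSOC f g zbar) (hS : WSRCQ g zbar) :
    ∃ C : ℝ, 0 < C ∧ ∃ U : Set (Em m × Mat n), IsOpen U ∧ zbar ∈ U ∧
      (∀ z ∈ lstratum g p q ∩ U, KKTF f g z = 0 → z = zbar) ∧
      (∀ z ∈ lstratum g p q ∩ U, C * pnorm (z - zbar) ≤ pnorm (KKTF f g z)) := by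
  obtain ⟨C, hC, hev⟩ :=
    StratumErrorBound.eventually_error_bound (p := p) (q := q) hf hg hgs hkkt hz hW hS
  obtain ⟨U, hU, hUo, hzU⟩ := eventually_nhds_iff.1 hev
  refine ⟨C, hC, U, hUo, hzU, fun z hz0 hF => ?_, fun z hz0 => hU z hz0.2 hz0.1⟩
  have h := hU z hz0.2 hz0.1
  have h0 : pnorm (0 : Em m × Mat n) = 0 := by simp [pnorm]
  rw [hF, h0] at h
  have hn : ‖z - zbar‖ ≤ 0 :=
    (StratumErrorBound.norm_le_pnorm _).trans (nonpos_of_mul_nonpos_right h hC)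
  exact sub_eq_zero.1 (norm_le_zero_iff.1 hn)
end

section
/- Let z̄ ∈ M̃_{p,q} be such that the W-SOC and the W-SRCQ hold at z̄. Then there exist an open neighborhood V of z̄ in ℝ^m × S^n and a constant c > 0 such that for every z ∈ V ∩ M̃_{p,q}, the linear map 𝒜_z is injective and ‖𝒜_z(v,H)‖ ≥ c·‖(v,H)‖ for all (v,H) ∈ ℝ^m × T_z; equivalently, the self-adjoint operator 𝒜_z*𝒜_z on ℝ^m × T_z is invertible with ‖(𝒜_z*𝒜_z)^{-1}‖ ≤ c^{-2} uniformly for z ∈ V ∩ M̃_{p,q}. -/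
open scoped Classical RealInnerProductSpace
open Matrix Set

open Filter Topology

theorem IsEigDecomp.ncard_eq {A P P' : Mat n} {lam lam' : Fin n → ℝ}
    (h : IsEigDecomp A P lam) (h' : IsEigDecomp A P' lam') (s : Set ℝ) :
    {i | lam i ∈ s}.ncard = {i | lam' i ∈ s}.ncard := by
  have key : ∀ {Q : Mat n} {mu : Fin n → ℝ}, IsEigDecomp A Q mu →
      {i | mu i ∈ s}.ncard = (A.charpoly.roots.filter (· ∈ s)).card := by
    intro Q mu hQ
    obtain ⟨⟨h1, h2⟩, -, rfl⟩ := hQ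
    have hr : (∏ i, (Polynomial.X - Polynomial.C (mu i))).roots =
        Finset.univ.val.map mu := by
      rw [← Polynomial.roots_multiset_prod_X_sub_C (Finset.univ.val.map mu), Multiset.map_map]
      rfl
    rw [Matrix.mul_assoc, Matrix.charpoly_mul_comm, Matrix.mul_assoc, h2, Matrix.mul_one,
      Matrix.charpoly_diagonal, hr, Multiset.filter_map, Multiset.card_map,
      Set.ncard_eq_toFinset_card']
    simp [Finset.card_def, Finset.filter_val]
  rw [key h, key h']

theorem minner_eq_sum (A B : Mat n) : minner A B = ∑ i, ∑ j, A i j * B i j := by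
  simp only [minner, Matrix.trace, Matrix.diag, Matrix.mul_apply, Matrix.transpose_apply]
  exact Finset.sum_comm

theorem minner_self (A : Mat n) : minner A A = ‖A‖ ^ 2 := by
  rw [minner_eq_sum, Matrix.frobenius_norm_def, ← Real.sqrt_eq_rpow, Real.sq_sqrt (by positivity)]
  simp [sq]

theorem IsOrthoMat.minner_conj {P : Mat n} (hP : IsOrthoMat P) (A B : Mat n) :
    minner (Pᵀ * A * P) (Pᵀ * B * P) = minner A B := by
  have h : (Pᵀ * A * P)ᵀ * (Pᵀ * B * P) = Pᵀ * (Aᵀ * B * P) := by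
    simp only [Matrix.transpose_mul, Matrix.transpose_transpose, Matrix.mul_assoc]
    rw [← Matrix.mul_assoc P Pᵀ, hP.1, Matrix.one_mul]
  rw [minner, h, Matrix.trace_mul_comm, Matrix.mul_assoc, hP.1, Matrix.mul_one, minner]

theorem IsOrthoMat.conj_conj {P : Mat n} (hP : IsOrthoMat P) (M : Mat n) :
    Pᵀ * (P * M * Pᵀ) * P = M := by
  simp only [Matrix.mul_assoc]
  rw [hP.2, Matrix.mul_one, ← Matrix.mul_assoc, hP.2, Matrix.one_mul]

theorem gradg_sub (g : Em m → Mat n) (x : Em m) (A B : Mat n) :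
    gradg g x (A - B) = gradg g x A - gradg g x B := by
  ext k
  simp [gradg, Matrix.sub_mul]

theorem gradg_smul (g : Em m → Mat n) (x : Em m) (c : ℝ) (A : Mat n) :
    gradg g x (c • A) = c • gradg g x A := by
  ext k
  simp [gradg]

theorem inner_gradg (g : Em m → Mat n) (x : Em m) (H : Mat n) (v : Em m) :
    ⟪v, gradg g x H⟫ = minner H (fderiv ℝ g x v) := by
  have hv : v = ∑ k, v k • EuclideanSpace.single k (1 : ℝ) := by
    ext i
    simp [Finset.sum_apply, Pi.single_apply]
  conv_rhs => rw [hv]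
  simp only [minner, map_sum, map_smul, Matrix.mul_sum, Matrix.trace_sum, Matrix.mul_smul,
    Matrix.trace_smul, smul_eq_mul]
  simp [PiLp.inner_apply, gradg, mul_comm]

theorem IsOrthoMat.conj_xiMap {P : Mat n} (hP : IsOrthoMat P) (lam : Fin n → ℝ) (H : Mat n) :
    Pᵀ * xiMap P lam H * P = Matrix.of fun i j =>
      if 0 < lam i ∧ 0 < lam j then (Pᵀ * H * P) i j
      else if 0 < lam i ∧ lam j = 0 then (Pᵀ * H * P) i j
      else if lam i = 0 ∧ 0 < lam j then (Pᵀ * H * P) i j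
      else if 0 < lam i ∧ lam j < 0 then (lam i / (lam i - lam j)) * (Pᵀ * H * P) i j
      else if lam i < 0 ∧ 0 < lam j then (lam j / (lam j - lam i)) * (Pᵀ * H * P) i j
      else 0 := by
  rw [xiMap, hP.conj_conj]

theorem xiMap_sub (P : Mat n) (lam : Fin n → ℝ) (A B : Mat n) :
    xiMap P lam (A - B) = xiMap P lam A - xiMap P lam B := by
  simp only [xiMap]
  rw [← Matrix.sub_mul, ← Matrix.mul_sub]
  congr 2
  ext i j
  simp only [Matrix.mul_sub, Matrix.sub_mul, Matrix.sub_apply, Matrix.of_apply]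
  split_ifs <;> ring

theorem xiMap_smul (P : Mat n) (lam : Fin n → ℝ) (c : ℝ) (A : Mat n) :
    xiMap P lam (c • A) = c • xiMap P lam A := by
  simp only [xiMap]
  rw [← Matrix.smul_mul, ← Matrix.mul_smul]
  congr 2
  ext i j
  simp only [Matrix.mul_smul, Matrix.smul_mul, Matrix.smul_apply, Matrix.of_apply, smul_eq_mul]
  split_ifs <;> ring

theorem Amap_sub (f : Em m → ℝ) (g : Em m → Mat n) (z : Em m × Mat n) (P : Mat n)
    (lam : Fin n → ℝ) (v w : Em m) (A B : Mat n) :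
    Amap f g z P lam (v - w) (A - B) = Amap f g z P lam v A - Amap f g z P lam w B := by
  ext1
  · simp only [Amap, map_sub, gradg_sub, Prod.fst_sub]
    abel
  · simp only [Amap, map_sub, xiMap_sub, Prod.snd_sub]
    abel

theorem Amap_smul (f : Em m → ℝ) (g : Em m → Mat n) (z : Em m × Mat n) (P : Mat n)
    (lam : Fin n → ℝ) (c : ℝ) (v : Em m) (A : Mat n) :
    Amap f g z P lam (c • v) (c • A) = c • Amap f g z P lam v A := by
  ext1
  · simp only [Amap, map_smul, gradg_smul, Prod.smul_fst, smul_add, smul_sub]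
  · simp only [Amap, map_smul, xiMap_smul, Prod.smul_snd, smul_add, smul_neg]

theorem memTz.sub {P : Mat n} {lam : Fin n → ℝ} {A B : Mat n}
    (hA : memTz P lam A) (hB : memTz P lam B) : memTz P lam (A - B) := by
  refine ⟨hA.1.sub hB.1, fun i j hi hj => ?_⟩
  simp [Matrix.mul_sub, Matrix.sub_mul, hA.2 i j hi hj, hB.2 i j hi hj]

theorem memTz.smul {P : Mat n} {lam : Fin n → ℝ} {A : Mat n}
    (hA : memTz P lam A) (c : ℝ) : memTz P lam (c • A) := by
  refine ⟨hA.1.smul c, fun i j hi hj => ?_⟩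
  simp [hA.2 i j hi hj]

theorem pnorm_nonneg (w : Em m × Mat n) : 0 ≤ pnorm w := Real.sqrt_nonneg _

theorem pnorm_smul (c : ℝ) (w : Em m × Mat n) : pnorm (c • w) = |c| * pnorm w := by
  simp only [pnorm, Prod.smul_fst, Prod.smul_snd, norm_smul, mul_pow, ← mul_add]
  rw [Real.sqrt_mul (by positivity), Real.sqrt_sq (by positivity), Real.norm_eq_abs]

theorem eq_zero_of_pnorm_le_zero {w : Em m × Mat n} (h : pnorm w ≤ 0) : w = 0 := by
  have h1 := Real.sqrt_eq_zero'.1 (h.antisymm (Real.sqrt_nonneg _))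
  have h2 : ‖w.1‖ ^ 2 = 0 := by nlinarith [sq_nonneg ‖w.1‖, sq_nonneg ‖w.2‖]
  have h3 : ‖w.2‖ ^ 2 = 0 := by nlinarith [sq_nonneg ‖w.1‖, sq_nonneg ‖w.2‖]
  exact Prod.ext (by simpa using h2) (by simpa using h3)

theorem eq_zero_of_Amap_eq_zero {f : Em m → ℝ} {g : Em m → Mat n} {z : Em m × Mat n}
    (hW : WSOC f g z) (hS : WSRCQ g z) {P : Mat n} {lam : Fin n → ℝ}
    (hd : IsEigDecomp (Gmap g z) P lam) {v : Em m} {H : Mat n} (hH : memTz P lam H)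
    (h0 : Amap f g z P lam v H = 0) : v = 0 ∧ H = 0 := by
  have hP := hd.1
  obtain ⟨hHs, hHb⟩ := hH
  have h1 : hessL f g z.1 z.2 v - gradg g z.1 (fderiv ℝ g z.1 v) + gradg g z.1 H = 0 :=
    congrArg Prod.fst h0
  have h2 : -fderiv ℝ g z.1 v + xiMap P lam H = 0 := congrArg Prod.snd h0
  have hD : fderiv ℝ g z.1 v = xiMap P lam H := by
    rw [← sub_eq_zero, ← neg_eq_zero, ← h2]; abel
  have hDhat := hP.conj_xiMap lam H
  rw [← hD] at hDhat
  set K := Pᵀ * H * P with hK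
  have hKs : ∀ i j, K i j = K j i := by
    have : Kᵀ = K := by
      simp [hK, Matrix.transpose_mul, hHs.eq, Matrix.mul_assoc]
    exact fun i j => congrFun (congrFun this j) i
  set D := Pᵀ * fderiv ℝ g z.1 v * P with hDdef
  have hDe := fun i j => congrFun (congrFun hDhat i) j
  simp only [Matrix.of_apply] at hDe
  have hv : v = 0 := by
    by_contra hv
    refine hW P lam hd v hv ⟨?_, ?_, ?_⟩ ?_
    · intro i j hi hj
      rw [← hDdef, hDe]; simp [hi, hj]
    · intro i j hi hj
      rw [← hDdef, hDe]; simp [hi, hj.not_gt]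
    · intro i j hi hj
      rw [← hDdef, hDe]; simp [hi.not_gt, hj.not_gt, hi.ne]
    · have e1 : hessL f g z.1 z.2 v = gradg g z.1 (fderiv ℝ g z.1 v) - gradg g z.1 H := by
        rw [← sub_eq_zero, ← h1]; abel
      rw [Qform, e1, inner_sub_right, inner_gradg, inner_gradg, ← hP.minner_conj,
        ← hP.minner_conj H, ← hDdef, ← hK, minner_eq_sum, minner_eq_sum, two_mul]
      nth_rewrite 4 [Finset.sum_comm]
      simp only [← Finset.sum_add_distrib, ← Finset.sum_sub_distrib]
      refine Finset.sum_eq_zero fun i _ => Finset.sum_eq_zero fun j _ => ?_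
      rw [hDe i j, hDe j i, hKs j i]
      rcases lt_trichotomy (lam i) 0 with hi | hi | hi <;>
      rcases lt_trichotomy (lam j) 0 with hj | hj | hj <;>
      simp [hi, hj, not_lt_of_gt, ne_of_lt, ne_of_gt]
      · have : lam j - lam i ≠ 0 := by linarith
        field_simp
        ring
      · have : lam i - lam j ≠ 0 := by linarith
        field_simp
        ring
  refine ⟨hv, ?_⟩
  have hD0 : D = 0 := by simp [hDdef, hv]
  rw [hv] at h1
  simp only [map_zero, sub_eq_add_neg, zero_add] at h1
  have hg0 : gradg g z.1 (0 : Mat n) = 0 := by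
    simpa using gradg_sub g z.1 (0 : Mat n) 0
  rw [hg0, neg_zero, zero_add] at h1
  obtain ⟨w, B, hBs, hB1, hB2, hC⟩ := hS P lam hd H hHs
  have hz : minner H H = 0 := by
    have : minner H H = minner H (fderiv ℝ g z.1 w) + minner H (P * B * Pᵀ) := by
      conv_lhs => rw [hC]
      conv_rhs => rw [hC]
      simp only [minner, Matrix.mul_add, Matrix.trace_add]
    rw [this, ← inner_gradg, h1, inner_zero_right, zero_add, ← hP.minner_conj, hP.conj_conj,
      ← hK, minner_eq_sum]
    refine Finset.sum_eq_zero fun i _ => Finset.sum_eq_zero fun j _ => ?_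
    have hd := hDe i j
    rw [hD0, Matrix.zero_apply] at hd
    rcases lt_trichotomy (lam i) 0 with hi | hi | hi <;>
    rcases lt_trichotomy (lam j) 0 with hj | hj | hj
    · simp [hB2 i j hi hj]
    · rw [← hBs.apply i j]; simp [hB1 j i hj hi]
    · have h3 : lam j - lam i ≠ 0 := by linarith
      simp [hi, hj, hi.not_gt, hj.not_gt, hi.ne, hj.ne', h3] at hd
      simp [hd]
    · simp [hB1 i j hi hj]
    · rw [hHb i j hi hj, zero_mul]
    · simp [hi, hj] at hd
      simp [← hd]
    · have h3 : lam i - lam j ≠ 0 := by linarith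
      simp [hi, hj, hj.not_gt, hj.ne, hi.ne', h3] at hd
      simp [hd]
    · simp [hi, hj] at hd
      simp [← hd]
    · simp [hi, hj] at hd
      simp [← hd]
  rw [minner_self] at hz
  simpa using hz

theorem continuous_hessL {f : Em m → ℝ} {g : Em m → Mat n}
    (hf : ContDiff ℝ 2 f) (hg : ContDiff ℝ 2 g) :
    Continuous fun z : Em m × Mat n => hessL f g z.1 z.2 := by
  have hL : ContDiff ℝ 2 fun r : (Em m × Mat n) × Em m => Lfun f g r.2 r.1.2 := by
    simp only [Lfun, minner_eq_sum]
    have hlin : ∀ i j, ContDiff ℝ 2 fun A : Mat n => A i j := fun i j =>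
      (LinearMap.toContinuousLinearMap (Matrix.entryLinearMap ℝ ℝ i j)).contDiff
    refine (hf.comp contDiff_snd).add (ContDiff.sum fun i _ => ContDiff.sum fun j _ => ?_)
    exact ((hlin i j).comp (contDiff_snd.comp contDiff_fst)).mul
      ((hlin i j).comp (hg.comp contDiff_snd))
  have h1 : ContDiff ℝ 1 fun r : (Em m × Mat n) × Em m =>
      fderiv ℝ (fun w => Lfun f g w r.1.2) r.2 := by
    refine ContDiff.fderiv (m := 2) (f := fun r : (Em m × Mat n) × Em m =>
      fun w => Lfun f g w r.1.2) ?_ contDiff_snd (by norm_num)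
    exact hL.comp ((contDiff_fst.comp contDiff_fst).prodMk contDiff_snd)
  have h2 : ContDiff ℝ 1 fun r : (Em m × Mat n) × Em m =>
      gradient (fun w => Lfun f g w r.1.2) r.2 :=
    (InnerProductSpace.toDual ℝ (Em m)).symm.toContinuousLinearEquiv.contDiff.comp h1
  have h3 : ContDiff ℝ 0 fun z : Em m × Mat n => hessL f g z.1 z.2 :=
    ContDiff.fderiv (m := 1) (f := fun z : Em m × Mat n =>
      fun u => gradient (fun w => Lfun f g w z.2) u) h2 contDiff_fst (by norm_num)
  exact h3.continuous

theorem continuous_gradg {g : Em m → Mat n} (hg : ContDiff ℝ 2 g) :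
    Continuous fun r : Em m × Mat n => gradg g r.1 r.2 := by
  have hd : Continuous (fderiv ℝ g) := hg.continuous_fderiv (by norm_num)
  refine (EuclideanSpace.equiv (Fin m) ℝ).symm.continuous.comp (continuous_pi fun k => ?_)
  refine Continuous.matrix_trace (Continuous.matrix_mul continuous_snd.matrix_transpose ?_)
  exact (hd.comp continuous_fst).clm_apply continuous_const

theorem eventually_sign_eq {A : ℕ → Mat n} {B : Mat n} {P : ℕ → Mat n} {Q : Mat n}
    {lam : ℕ → Fin n → ℝ} {mu : Fin n → ℝ} {p q : ℕ}
    (hA : ∀ k, IsEigDecomp (A k) (P k) (lam k)) (hAs : ∀ k, A k ∈ stratum n p q)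
    (hB : IsEigDecomp B Q mu) (hBs : B ∈ stratum n p q) (hlim : Tendsto lam atTop (𝓝 mu)) :
    ∀ᶠ k in atTop, ∀ i, SignType.sign (lam k i) = SignType.sign (mu i) := by
  have hlim' := fun i => (tendsto_pi_nhds.1 hlim) i
  have hpos : ∀ᶠ k in atTop, ∀ i, 0 < mu i → 0 < lam k i :=
    eventually_all.2 fun i => by
      by_cases h : 0 < mu i
      · exact ((hlim' i).eventually_const_lt h).mono fun k hk _ => hk
      · simp [h]
  have hneg : ∀ᶠ k in atTop, ∀ i, mu i < 0 → lam k i < 0 :=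
    eventually_all.2 fun i => by
      by_cases h : mu i < 0
      · exact ((hlim' i).eventually_lt_const h).mono fun k hk _ => hk
      · simp [h]
  have hcount : ∀ {C R : Mat n} {nu : Fin n → ℝ}, IsEigDecomp C R nu → C ∈ stratum n p q →
      {i | 0 < nu i}.ncard = p ∧ {i | nu i < 0}.ncard = q := by
    rintro C R nu hC ⟨R', nu', hC', h1, h2⟩
    exact ⟨(hC.ncard_eq hC' (Ioi 0)).trans h1, (hC.ncard_eq hC' (Iio 0)).trans h2⟩
  filter_upwards [hpos, hneg] with k hk1 hk2 i
  have e1 : {i | 0 < mu i} = {i | 0 < lam k i} :=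
    Set.eq_of_subset_of_ncard_le hk1
      ((hcount (hA k) (hAs k)).1.trans (hcount hB hBs).1.symm).le (Set.toFinite _)
  have e2 : {i | mu i < 0} = {i | lam k i < 0} :=
    Set.eq_of_subset_of_ncard_le hk2
      ((hcount (hA k) (hAs k)).2.trans (hcount hB hBs).2.symm).le (Set.toFinite _)
  have e1' : 0 < mu i ↔ 0 < lam k i := Set.ext_iff.1 e1 i
  have e2' : mu i < 0 ↔ lam k i < 0 := Set.ext_iff.1 e2 i
  simp only [sign_apply, e1', e2']

theorem tendsto_xiMap {P H : ℕ → Mat n} {Q K : Mat n} {lam : ℕ → Fin n → ℝ} {mu : Fin n → ℝ}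
    (hP : Tendsto P atTop (𝓝 Q)) (hH : Tendsto H atTop (𝓝 K)) (hlam : Tendsto lam atTop (𝓝 mu))
    (hs : ∀ᶠ k in atTop, ∀ i, SignType.sign (lam k i) = SignType.sign (mu i)) :
    Tendsto (fun k => xiMap (P k) (lam k) (H k)) atTop (𝓝 (xiMap Q mu K)) := by
  have htr : Continuous fun A : Mat n => Aᵀ := by fun_prop
  have hPt : Tendsto (fun k => (P k)ᵀ) atTop (𝓝 Qᵀ) := (htr.tendsto Q).comp hP
  have hconj : Tendsto (fun k => (P k)ᵀ * H k * P k) atTop (𝓝 (Qᵀ * K * Q)) :=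
    (hPt.mul hH).mul hP
  refine Tendsto.mul (Tendsto.mul hP ?_) hPt
  refine tendsto_pi_nhds.2 fun i => tendsto_pi_nhds.2 fun j => ?_
  have hij : Tendsto (fun k => ((P k)ᵀ * H k * P k) i j) atTop (𝓝 ((Qᵀ * K * Q) i j)) :=
    (tendsto_pi_nhds.1 ((tendsto_pi_nhds.1 hconj) i)) j
  have hl := tendsto_pi_nhds.1 hlam
  have hs' : ∀ᶠ k in atTop, ∀ i, (0 < lam k i ↔ 0 < mu i) ∧ (lam k i < 0 ↔ mu i < 0) ∧
      (lam k i = 0 ↔ mu i = 0) := by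
    filter_upwards [hs] with k hk i
    rw [← sign_eq_one_iff, ← sign_eq_neg_one_iff, ← sign_eq_zero_iff, hk i, sign_eq_one_iff,
      sign_eq_neg_one_iff, sign_eq_zero_iff]
    simp
  have hfrac : ∀ a b, 0 < mu a → mu b < 0 →
      Tendsto (fun k => lam k a / (lam k a - lam k b) * ((P k)ᵀ * H k * P k) i j) atTop
        (𝓝 (mu a / (mu a - mu b) * (Qᵀ * K * Q) i j)) := fun a b ha hb =>
    ((hl a).div ((hl a).sub (hl b)) (by linarith)).mul hij
  simp only [Matrix.of_apply]
  refine Tendsto.congr' (f₁ := fun k =>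
    if 0 < mu i ∧ 0 < mu j then ((P k)ᵀ * H k * P k) i j
    else if 0 < mu i ∧ mu j = 0 then ((P k)ᵀ * H k * P k) i j
    else if mu i = 0 ∧ 0 < mu j then ((P k)ᵀ * H k * P k) i j
    else if 0 < mu i ∧ mu j < 0 then
      (lam k i / (lam k i - lam k j)) * ((P k)ᵀ * H k * P k) i j
    else if mu i < 0 ∧ 0 < mu j then
      (lam k j / (lam k j - lam k i)) * ((P k)ᵀ * H k * P k) i j
    else 0) ?_ ?_
  · filter_upwards [hs'] with k hk
    simp only [hk]
  · split_ifs with h1 h2 h3 h4 h5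
    · exact hij
    · exact hij
    · exact hij
    · exact hfrac i j h4.1 h4.2
    · exact hfrac j i h5.2 h5.1
    · exact tendsto_const_nhds

theorem Continuous.tendsto_comp_prodMk {ι X Y Z : Type*} [TopologicalSpace X]
    [TopologicalSpace Y] [TopologicalSpace Z] {F : X × Y → Z} (hF : Continuous F) {l : Filter ι}
    {x : ι → X} {y : ι → Y} {a : X} {b : Y} (hx : Tendsto x l (𝓝 a)) (hy : Tendsto y l (𝓝 b)) :
    Tendsto (fun k => F (x k, y k)) l (𝓝 (F (a, b))) :=
  (hF.tendsto (a, b)).comp (hx.prodMk_nhds hy)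

theorem tendsto_Amap {f : Em m → ℝ} {g : Em m → Mat n} (hf : ContDiff ℝ 2 f)
    (hg : ContDiff ℝ 2 g) {z : ℕ → Em m × Mat n} {P H : ℕ → Mat n} {lam : ℕ → Fin n → ℝ}
    {v : ℕ → Em m} {zbar : Em m × Mat n} {Q K : Mat n} {mu : Fin n → ℝ} {w : Em m}
    (hz : Tendsto z atTop (𝓝 zbar)) (hP : Tendsto P atTop (𝓝 Q))
    (hlam : Tendsto lam atTop (𝓝 mu)) (hv : Tendsto v atTop (𝓝 w))
    (hH : Tendsto H atTop (𝓝 K))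
    (hs : ∀ᶠ k in atTop, ∀ i, SignType.sign (lam k i) = SignType.sign (mu i)) :
    Tendsto (fun k => Amap f g (z k) (P k) (lam k) (v k) (H k)) atTop
      (𝓝 (Amap f g zbar Q mu w K)) := by
  have hx : Tendsto (fun k => (z k).1) atTop (𝓝 zbar.1) := (continuous_fst.tendsto _).comp hz
  have hdg : Continuous fun r : Em m × Em m => fderiv ℝ g r.1 r.2 :=
    ((hg.continuous_fderiv (by norm_num)).comp continuous_fst).clm_apply continuous_snd
  have hhess : Continuous fun r : (Em m × Mat n) × Em m => hessL f g r.1.1 r.1.2 r.2 :=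
    ((continuous_hessL hf hg).comp continuous_fst).clm_apply continuous_snd
  have ldg := hdg.tendsto_comp_prodMk hx hv
  have lhess := hhess.tendsto_comp_prodMk hz hv
  have lgrad := (continuous_gradg hg).tendsto_comp_prodMk hx ldg
  have lgradH := (continuous_gradg hg).tendsto_comp_prodMk hx hH
  dsimp only at ldg lhess lgrad lgradH
  have lxi := tendsto_xiMap hP hH hlam hs
  have l1 := (lhess.sub lgrad).add lgradH
  have l2 : Tendsto (fun k => -fderiv ℝ g (z k).1 (v k) + xiMap (P k) (lam k) (H k)) atTop
      (𝓝 (-fderiv ℝ g zbar.1 w + xiMap Q mu K)) := ldg.neg.add lxi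
  exact l1.prodMk_nhds l2

theorem IsOrthoMat.norm_sq {P : Mat n} (hP : IsOrthoMat P) : ‖P‖ ^ 2 = n := by
  rw [← minner_self, minner, hP.2]
  simp

theorem IsEigDecomp.norm_le {A P : Mat n} {lam : Fin n → ℝ} (h : IsEigDecomp A P lam) :
    ‖lam‖ ≤ n * ‖A‖ := by
  have hP := h.1
  have hdiag : Matrix.diagonal lam = Pᵀ * A * P := by rw [h.2.2, hP.conj_conj]
  have h1 : ‖lam‖ ≤ ‖Matrix.diagonal lam‖ := by
    rw [Matrix.frobenius_norm_diagonal]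
    exact (pi_norm_le_iff_of_nonneg (norm_nonneg _)).2 fun i =>
      PiLp.norm_apply_le (WithLp.toLp 2 lam) i
  calc ‖lam‖ ≤ ‖Pᵀ * A * P‖ := hdiag ▸ h1
    _ ≤ ‖Pᵀ‖ * ‖A‖ * ‖P‖ := (Matrix.frobenius_norm_mul _ _).trans
        (mul_le_mul_of_nonneg_right (Matrix.frobenius_norm_mul _ _) (norm_nonneg _))
    _ = ‖P‖ ^ 2 * ‖A‖ := by rw [Matrix.frobenius_norm_transpose]; ring
    _ = n * ‖A‖ := by rw [hP.norm_sq]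

theorem isClosed_isEigDecomp :
    IsClosed {r : Mat n × Mat n × (Fin n → ℝ) | IsEigDecomp r.1 r.2.1 r.2.2} := by
  have hA : Continuous fun r : Mat n × Mat n × (Fin n → ℝ) => r.1 := continuous_fst
  have hP : Continuous fun r : Mat n × Mat n × (Fin n → ℝ) => r.2.1 :=
    continuous_fst.comp continuous_snd
  have hl : Continuous fun r : Mat n × Mat n × (Fin n → ℝ) => r.2.2 :=
    continuous_snd.comp continuous_snd
  have hPt := hP.matrix_transpose
  refine IsClosed.inter (IsClosed.inter ?_ ?_) (IsClosed.inter ?_ ?_)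
  · exact isClosed_eq (hP.mul hPt) continuous_const
  · exact isClosed_eq (hPt.mul hP) continuous_const
  · have : {r : Mat n × Mat n × (Fin n → ℝ) | Antitone r.2.2} =
        ⋂ i, ⋂ j, ⋂ (_ : i ≤ j), {r | r.2.2 j ≤ r.2.2 i} := by
      ext r; simp [Antitone]
    change IsClosed {r : Mat n × Mat n × (Fin n → ℝ) | Antitone r.2.2}
    rw [this]
    exact isClosed_iInter fun i => isClosed_iInter fun j => isClosed_iInter fun _ =>
      isClosed_le ((continuous_apply j).comp hl) ((continuous_apply i).comp hl)
  · exact isClosed_eq hA ((hP.mul hl.matrix_diagonal).mul hPt)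

theorem exists_le_pnorm_Amap {p q : ℕ} {f : Em m → ℝ} {g : Em m → Mat n}
    (hf : ContDiff ℝ 2 f) (hg : ContDiff ℝ 2 g) {zbar : Em m × Mat n}
    (hz : zbar ∈ lstratum g p q) (hW : WSOC f g zbar) (hS : WSRCQ g zbar) :
    ∃ c : ℝ, 0 < c ∧ ∀ z ∈ Metric.ball zbar c ∩ lstratum g p q, ∀ P lam,
      IsEigDecomp (Gmap g z) P lam → ∀ v H, memTz P lam H → ‖v‖ ^ 2 + ‖H‖ ^ 2 = 1 →
        c ≤ pnorm (Amap f g z P lam v H) := by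
  by_contra! hcon
  choose z hzk P lam hd v H hH hn hlt using fun k : ℕ =>
    hcon (1 / ((k : ℝ) + 1)) Nat.one_div_pos_of_nat
  have hc0 : Tendsto (fun k : ℕ => 1 / ((k : ℝ) + 1)) atTop (𝓝 0) :=
    tendsto_one_div_add_atTop_nhds_zero_nat
  have hzlim : Tendsto z atTop (𝓝 zbar) :=
    tendsto_iff_dist_tendsto_zero.2
      (squeeze_zero (fun _ => dist_nonneg) (fun k => (hzk k).1.le) hc0)
  have hGc : Continuous (Gmap g) := (hg.continuous.comp continuous_fst).add continuous_snd
  have hG : Tendsto (fun k => Gmap g (z k)) atTop (𝓝 (Gmap g zbar)) :=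
    (hGc.tendsto zbar).comp hzlim
  obtain ⟨C, hC⟩ := (Metric.isBounded_range_of_tendsto _ hG).exists_norm_le
  have hbdd : Bornology.IsBounded
      (range fun k => (P k, lam k, v k, H k)) := by
    refine isBounded_iff_forall_norm_le.2 ⟨max (n + 1) (max (n * C) 1), ?_⟩
    rintro _ ⟨k, rfl⟩
    have hP2 := (hd k).1.norm_sq
    have hl := (hd k).norm_le
    have hCk := hC _ (mem_range_self k)
    have hnk := hn k
    have e1 : ‖P k‖ ≤ n + 1 := by nlinarith [norm_nonneg (P k), (Nat.cast_nonneg n : (0:ℝ) ≤ n)]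
    have e2 : ‖lam k‖ ≤ n * C := hl.trans (by gcongr)
    have e3 : ‖v k‖ ≤ 1 := by nlinarith [norm_nonneg (v k), sq_nonneg ‖H k‖]
    have e4 : ‖H k‖ ≤ 1 := by nlinarith [norm_nonneg (H k), sq_nonneg ‖v k‖]
    simp only [Prod.norm_def]
    exact max_le_max e1 (max_le_max e2 (max_le e3 e4))
  obtain ⟨⟨Q, mu, w, K⟩, -, φ, hφ, hlim⟩ :=
    tendsto_subseq_of_bounded hbdd (fun k => mem_range_self k)
  have hφt := hφ.tendsto_atTop
  have lP : Tendsto (fun k => P (φ k)) atTop (𝓝 Q) := (continuous_fst.tendsto _).comp hlim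
  have hlim2 := (continuous_snd.tendsto _).comp hlim
  have ll : Tendsto (fun k => lam (φ k)) atTop (𝓝 mu) := (continuous_fst.tendsto _).comp hlim2
  have hlim3 := (continuous_snd.tendsto _).comp hlim2
  have lv : Tendsto (fun k => v (φ k)) atTop (𝓝 w) := (continuous_fst.tendsto _).comp hlim3
  have lH : Tendsto (fun k => H (φ k)) atTop (𝓝 K) := (continuous_snd.tendsto _).comp hlim3
  have lz := hzlim.comp hφt
  have hdec : IsEigDecomp (Gmap g zbar) Q mu :=
    isClosed_isEigDecomp.mem_of_tendsto
      ((hG.comp hφt).prodMk_nhds (lP.prodMk_nhds ll)) (Eventually.of_forall fun k => hd (φ k))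
  have hsign := eventually_sign_eq (fun k => hd (φ k)) (fun k => (hzk (φ k)).2.2) hdec hz.2 ll
  have htr : Continuous fun A : Mat n => Aᵀ := by fun_prop
  have hT : memTz Q mu K := by
    refine ⟨?_, fun i j hi hj => ?_⟩
    · exact tendsto_nhds_unique (((htr.tendsto K).comp lH).congr fun k => (hH (φ k)).1) lH
    · have hconj : Tendsto (fun k => (P (φ k))ᵀ * H (φ k) * P (φ k)) atTop (𝓝 (Qᵀ * K * Q)) :=
        (((htr.tendsto Q).comp lP).mul lH).mul lP
      refine tendsto_nhds_unique ((tendsto_pi_nhds.1 ((tendsto_pi_nhds.1 hconj) i)) j)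
        (tendsto_const_nhds.congr' ?_)
      filter_upwards [hsign] with k hk
      refine ((hH (φ k)).2 i j ?_ ?_).symm
      · rw [← sign_eq_zero_iff, hk, hi, sign_zero]
      · rw [← sign_eq_zero_iff, hk, hj, sign_zero]
  have lA := tendsto_Amap hf hg lz lP ll lv lH hsign
  have hpc : Continuous (pnorm : Em m × Mat n → ℝ) :=
    Real.continuous_sqrt.comp ((continuous_fst.norm.pow 2).add (continuous_snd.norm.pow 2))
  have hp0 : pnorm (Amap f g zbar Q mu w K) = 0 :=
    tendsto_nhds_unique ((hpc.tendsto _).comp lA)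
      (squeeze_zero (fun _ => Real.sqrt_nonneg _) (fun k => (hlt (φ k)).le) (hc0.comp hφt))
  have hA0 := eq_zero_of_pnorm_le_zero hp0.le
  obtain ⟨hw, hK⟩ := eq_zero_of_Amap_eq_zero hW hS hdec hT hA0
  have hn1 : ‖w‖ ^ 2 + ‖K‖ ^ 2 = 1 :=
    tendsto_nhds_unique ((lv.norm.pow 2).add (lH.norm.pow 2))
      (tendsto_const_nhds.congr fun k => (hn (φ k)).symm)
  simp [hw, hK] at hn1

/-- If the W-SOC and the W-SRCQ hold at `z̄ ∈ M̃_{p,q}`, then on a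
neighborhood of `z̄` (intersected with the stratum) the differentials `𝒜_z` are injective
with a uniform lower bound `‖𝒜_z(v,H)‖ ≥ c‖(v,H)‖`. -/
theorem Amap_uniformly_injective_near {m n p q : ℕ}
    (f : Em m → ℝ) (g : Em m → Mat n)
    (hf : ContDiff ℝ 2 f) (hg : ContDiff ℝ 2 g) (hgs : ∀ x, (g x).IsSymm)
    (zbar : Em m × Mat n)
    (hz : zbar ∈ lstratum g p q)
    (hW : WSOC f g zbar) (hS : WSRCQ g zbar) :
    ∃ V : Set (Em m × Mat n), IsOpen V ∧ zbar ∈ V ∧ ∃ c : ℝ, 0 < c ∧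
      ∀ z ∈ V ∩ lstratum g p q, ∀ P lam, IsEigDecomp (Gmap g z) P lam →
        (∀ v₁ H₁ v₂ H₂, memTz P lam H₁ → memTz P lam H₂ →
            Amap f g z P lam v₁ H₁ = Amap f g z P lam v₂ H₂ → v₁ = v₂ ∧ H₁ = H₂) ∧
        (∀ v H, memTz P lam H →
            c * Real.sqrt (‖v‖ ^ 2 + ‖H‖ ^ 2) ≤ pnorm (Amap f g z P lam v H)) := by
  obtain ⟨c, hc, hb⟩ := exists_le_pnorm_Amap hf hg hz hW hS
  refine ⟨Metric.ball zbar c, Metric.isOpen_ball, Metric.mem_ball_self hc, c, hc, ?_⟩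
  intro z hzV P lam hd
  have hbound : ∀ v H, memTz P lam H →
      c * pnorm (v, H) ≤ pnorm (Amap f g z P lam v H) := by
    intro v H hH
    rcases (pnorm_nonneg (v, H)).eq_or_lt with h0 | h0
    · rw [← h0, mul_zero]
      exact pnorm_nonneg _
    · set s := pnorm (v, H) with hs
      have hone : pnorm (s⁻¹ • (v, H)) = 1 := by
        rw [pnorm_smul, abs_of_pos (inv_pos.2 h0), ← hs, inv_mul_cancel₀ h0.ne']
      have h1 := hb z hzV P lam hd (s⁻¹ • v) (s⁻¹ • H) (hH.smul _) (Real.sqrt_eq_one.1 hone)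
      rw [Amap_smul, pnorm_smul, abs_of_pos (inv_pos.2 h0), inv_mul_eq_div, le_div_iff₀ h0] at h1
      exact h1
  refine ⟨fun v₁ H₁ v₂ H₂ h₁ h₂ he => ?_, hbound⟩
  have h := hbound (v₁ - v₂) (H₁ - H₂) (h₁.sub h₂)
  rw [Amap_sub, he, sub_self] at h
  have h0 : pnorm (0 : Em m × Mat n) = 0 := by simp [pnorm]
  have h1 := eq_zero_of_pnorm_le_zero (by nlinarith : pnorm (v₁ - v₂, H₁ - H₂) ≤ 0)
  exact ⟨sub_eq_zero.1 (congrArg Prod.fst h1), sub_eq_zero.1 (congrArg Prod.snd h1)⟩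
end

section
/- Let z̄ = (x̄,ȳ) ∈ ℝ^m × S^n. If the constraint nondegeneracy holds at z̄, then there exists an open neighborhood U of z̄ in ℝ^m × S^n such that the constraint nondegeneracy holds at every z ∈ U. -/
open scoped Classical RealInnerProductSpace
open Matrix Set

theorem minner_add_left {n : ℕ} (A B C : Mat n) :
    minner (A + B) C = minner A C + minner B C := by
  simp [minner, Matrix.add_mul]

theorem minner_add_right {n : ℕ} (A B C : Mat n) :
    minner A (B + C) = minner A B + minner A C := by
  simp [minner, Matrix.mul_add]

theorem minner_smul_left {n : ℕ} (c : ℝ) (A B : Mat n) :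
    minner (c • A) B = c * minner A B := by
  simp [minner]

theorem minner_transpose_left {n : ℕ} (A B : Mat n) : minner Aᵀ B = minner A Bᵀ := by
  rw [minner, minner, ← trace_transpose, transpose_mul, transpose_transpose, trace_mul_comm]

theorem Continuous.minner {X : Type*} [TopologicalSpace X] {n : ℕ} {a b : X → Mat n}
    (ha : Continuous a) (hb : Continuous b) : Continuous fun x => minner (a x) (b x) :=
  (ha.matrix_transpose.matrix_mul hb).matrix_trace

theorem exists_minner_eq {n : ℕ} (f : Mat n →ₗ[ℝ] ℝ) :
    ∃ Δ : Mat n, ∀ A, minner Δ A = f A := by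
  refine ⟨Matrix.of fun i j => f (Matrix.single i j 1), fun A => ?_⟩
  conv_rhs => rw [Matrix.matrix_eq_sum_single A]
  simp only [minner, Matrix.trace, Matrix.mul_apply, map_sum, diag_apply, transpose_apply,
    of_apply]
  rw [Finset.sum_comm]
  refine Finset.sum_congr rfl fun i _ => Finset.sum_congr rfl fun j _ => ?_
  rw [← mul_one (A i j), ← smul_eq_mul (A i j) 1, ← Matrix.smul_single, map_smul]
  simp [mul_comm]

/-- A symmetric matrix `Δ` that witnesses the failure of the constraint nondegeneracy at `z`,
relative to an orthogonal matrix `P` of eigenvectors of `G(z)`. -/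
structure IsDegenerateAt {m n : ℕ} (g : Em m → Mat n) (z : Em m × Mat n)
    (Δ P : Mat n) : Prop where
  decomp : IsEigDecomp (Gmap g z) P (Pᵀ * Gmap g z * P).diag
  isSymm : Δ.IsSymm
  fderiv : ∀ v, minner Δ (fderiv ℝ g z.1 v) = 0
  tangent : ∀ A : Mat n, A.IsSymm →
    minner Δ (P * (diagonal (fun i => max ((Pᵀ * Gmap g z * P) i i) 0) * A +
      A * diagonal (fun i => max ((Pᵀ * Gmap g z * P) i i) 0)) * Pᵀ) = 0

theorem IsEigDecomp.eq_diag {n : ℕ} {A P : Mat n} {lam : Fin n → ℝ} (h : IsEigDecomp A P lam) :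
    (Pᵀ * A * P).diag = lam := by
  obtain ⟨⟨-, h2⟩, -, rfl⟩ := h
  have : Pᵀ * (P * diagonal lam * Pᵀ) * P = (Pᵀ * P) * diagonal lam * (Pᵀ * P) := by
    simp only [Matrix.mul_assoc]
  rw [this, h2, Matrix.one_mul, Matrix.mul_one, diag_diagonal]

theorem isCompact_setOf_isOrthoMat (n : ℕ) : IsCompact {P : Mat n | IsOrthoMat P} := by
  have hK : IsCompact (Set.univ.pi fun _ : Fin n => Set.univ.pi fun _ : Fin n =>
      Set.Icc (-1 : ℝ) 1) :=
    isCompact_univ_pi fun _ => isCompact_univ_pi fun _ => isCompact_Icc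
  refine IsCompact.of_isClosed_subset (t := _) hK ?_ ?_
  · have h1 : Continuous fun P : Mat n => P * Pᵀ :=
      continuous_id.matrix_mul continuous_id.matrix_transpose
    have h2 : Continuous fun P : Mat n => Pᵀ * P :=
      continuous_id.matrix_transpose.matrix_mul continuous_id
    exact (isClosed_eq h1 continuous_const).inter (isClosed_eq h2 continuous_const)
  · intro P hP i _ j _
    have hU : P ∈ Matrix.unitaryGroup (Fin n) ℝ := Matrix.mem_unitaryGroup_iff.2 <| by
      simpa [star_eq_conjTranspose] using hP.1
    exact abs_le.1 (entry_norm_bound_of_unitary hU i j)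

theorem isSymm_fderiv {m n : ℕ} {g : Em m → Mat n} (hg : Differentiable ℝ g)
    (hgs : ∀ x, (g x).IsSymm) (x v : Em m) : (fderiv ℝ g x v).IsSymm := by
  let T : Mat n →L[ℝ] Mat n :=
    LinearMap.toContinuousLinearMap (transposeLinearEquiv (Fin n) (Fin n) ℝ ℝ).toLinearMap
  have h : HasFDerivAt (fun y => T (g y)) (T.comp (fderiv ℝ g x)) x :=
    T.hasFDerivAt.comp x (hg x).hasFDerivAt
  have hTg : (fun y => T (g y)) = g := funext hgs
  rw [hTg] at h
  exact (congrArg (fun L => L v) (h.unique (hg x).hasFDerivAt) : T (fderiv ℝ g x v) = _)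

theorem exists_isDegenerateAt_of_not_cNondeg {m n : ℕ} {g : Em m → Mat n}
    (hg : Differentiable ℝ g) (hgs : ∀ x, (g x).IsSymm) {z : Em m × Mat n}
    (h : ¬ CNondeg g z) :
    ∃ Δ P : Mat n, ‖Δ‖ = 1 ∧ IsOrthoMat P ∧ IsDegenerateAt g z Δ P := by
  simp only [CNondeg, not_forall] at h
  obtain ⟨P, lam, hP, C, hCs, hC⟩ := h
  set D : Mat n := diagonal fun i => max (lam i) 0 with hD
  have hDs : Dᵀ = D := diagonal_transpose _
  let S : Submodule ℝ (Mat n) :=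
    { carrier := {A | A.IsSymm}
      add_mem' := fun ha hb => Matrix.IsSymm.add ha hb
      zero_mem' := Matrix.isSymm_zero
      smul_mem' := fun c _ ha => Matrix.IsSymm.smul ha c }
  let L : Mat n →ₗ[ℝ] Mat n :=
    { toFun := fun A => P * (D * A + A * D) * Pᵀ
      map_add' := fun A B => by simp only [Matrix.mul_add, Matrix.add_mul]; abel
      map_smul' := fun c A => by simp [Matrix.mul_add, Matrix.add_mul] }
  have hsym : ∀ A : Mat n, A.IsSymm → (D * A + A * D).IsSymm := fun A hA => by
    simp [Matrix.IsSymm, transpose_mul, hDs, hA.eq, add_comm]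
  have hLs : ∀ A : Mat n, A.IsSymm → (L A).IsSymm := fun A hA => by
    change (P * (D * A + A * D) * Pᵀ)ᵀ = P * (D * A + A * D) * Pᵀ
    rw [transpose_mul, transpose_mul, (hsym A hA).eq, transpose_transpose, Matrix.mul_assoc]
  have hCnot : C ∉ LinearMap.range (fderiv ℝ g z.1).toLinearMap ⊔ S.map L := by
    intro hmem
    obtain ⟨_, ⟨v, rfl⟩, _, ⟨A, hA, rfl⟩, rfl⟩ := Submodule.mem_sup.1 hmem
    have hzero : ∀ i j, lam i ≤ 0 → lam j ≤ 0 → (D * A + A * D) i j = 0 := by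
      intro i j hi hj
      simp [hD, diagonal_mul, mul_diagonal, hi, hj]
    exact hC ⟨v, D * A + A * D, hsym A hA, fun i j hi hj => hzero i j hi.le hj.le,
      fun i j hi hj => hzero i j hi.le hj.le, fun i j hi hj => hzero i j hi.le hj.le, rfl⟩
  obtain ⟨f, hfC, hf⟩ := Submodule.exists_le_ker_of_notMem hCnot
  obtain ⟨Δ, hΔ⟩ := exists_minner_eq f
  have hΔ_sym : ∀ A : Mat n, A.IsSymm → minner (Δ + Δᵀ) A = 2 * f A := by
    intro A hA
    rw [minner_add_left, minner_transpose_left, hA.eq, hΔ]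
    ring
  have hΔ_ne : Δ + Δᵀ ≠ 0 := by
    intro h0
    have := hΔ_sym C hCs
    rw [h0] at this
    exact hfC (by simpa [minner] using this.symm)
  have hker : ∀ A : Mat n, A.IsSymm →
      A ∈ LinearMap.range (fderiv ℝ g z.1).toLinearMap ⊔ S.map L → minner (Δ + Δᵀ) A = 0 := by
    intro A hA hmem
    have : f A = 0 := hf hmem
    rw [hΔ_sym A hA, this, mul_zero]
  refine ⟨‖Δ + Δᵀ‖⁻¹ • (Δ + Δᵀ), P, ?_, hP.1, ?_, ?_, ?_, ?_⟩
  · rw [norm_smul, norm_inv, norm_norm, inv_mul_cancel₀ (norm_ne_zero_iff.2 hΔ_ne)]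
  · rwa [hP.eq_diag]
  · exact (Matrix.isSymm_add_transpose_self Δ).smul _
  · intro v
    have := hker _ (isSymm_fderiv hg hgs z.1 v) (Submodule.mem_sup_left ⟨v, rfl⟩)
    rw [minner_smul_left, this, mul_zero]
  · intro A hA
    have hlam : ∀ i, (Pᵀ * Gmap g z * P) i i = lam i := congrFun hP.eq_diag
    have := hker _ (hLs A hA) (Submodule.mem_sup_right ⟨A, hA, rfl⟩)
    simp only [hlam]
    rw [minner_smul_left]
    exact mul_eq_zero_of_right _ this

theorem IsDegenerateAt.eq_zero {m n : ℕ} {g : Em m → Mat n} {z : Em m × Mat n}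
    {Δ P : Mat n} (h : IsDegenerateAt g z Δ P) (hC : CNondeg g z) :
    Δ = 0 := by
  have hself : minner Δ Δ = 0 := by
    obtain ⟨v, B, hB, h1, h2, h3, hΔ⟩ := hC P _ h.decomp Δ h.isSymm
    nth_rewrite 2 [hΔ]
    rw [minner_add_right, h.fderiv, zero_add]
    set lam := (Pᵀ * Gmap g z * P).diag with hlam
    let d : Fin n → ℝ := fun i => max (lam i) 0
    have key := h.tangent (Matrix.of fun i j => B i j / (d i + d j)) (by
      ext i j
      simp [hB.apply i j, add_comm])
    convert key using 4
    ext i j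
    change B i j = (diagonal d * (_ : Mat n) + (_ : Mat n) * diagonal d) i j
    rw [Matrix.add_apply, diagonal_mul, mul_diagonal, of_apply]
    have hd : ∀ i, 0 ≤ d i := fun i => le_max_right _ _
    rcases eq_or_ne (d i + d j) 0 with h0 | h0
    · have hi : lam i ≤ 0 := (le_max_left _ _).trans (by linarith [hd i, hd j] : d i ≤ 0)
      have hj : lam j ≤ 0 := (le_max_left _ _).trans (by linarith [hd i, hd j] : d j ≤ 0)
      have : B i j = 0 := by
        rcases hi.lt_or_eq with hi | hi <;> rcases hj.lt_or_eq with hj | hj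
        · exact h3 i j hi hj
        · rw [← hB.apply i j]; exact h2 j i hj hi
        · exact h2 i j hi hj
        · exact h1 i j hi hj
      simp [this]
    · field_simp
  exact trace_conjTranspose_mul_self_eq_zero_iff.1 (by simpa [minner] using hself)

theorem isClosed_setOf_isDegenerateAt {m n : ℕ} {g : Em m → Mat n} (hg : ContDiff ℝ 1 g) :
    IsClosed {w : (Em m × Mat n) × (Mat n × Mat n) |
      IsOrthoMat w.2.2 ∧ IsDegenerateAt g w.1 w.2.1 w.2.2} := by
  let W := (Em m × Mat n) × (Mat n × Mat n)
  have hP : Continuous fun w : W => w.2.2 := continuous_snd.snd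
  have hPt : Continuous fun w : W => w.2.2ᵀ := hP.matrix_transpose
  have hΔ : Continuous fun w : W => w.2.1 := continuous_snd.fst
  have hG : Continuous fun w : W => Gmap g w.1 :=
    (hg.continuous.comp continuous_fst.fst).add continuous_fst.snd
  have hPGP : Continuous fun w : W => w.2.2ᵀ * Gmap g w.1 * w.2.2 :=
    (hPt.matrix_mul hG).matrix_mul hP
  have hfd : Continuous fun w : W => fderiv ℝ g w.1.1 :=
    (hg.continuous_fderiv one_ne_zero).comp continuous_fst.fst
  have hD : Continuous fun w : W =>
      diagonal fun i => max ((w.2.2ᵀ * Gmap g w.1 * w.2.2) i i) 0 :=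
    Continuous.matrix_diagonal <| continuous_pi fun i =>
      (hPGP.matrix_elem i i).max continuous_const
  have hort : IsClosed {w : W | IsOrthoMat w.2.2} :=
    (isCompact_setOf_isOrthoMat n).isClosed.preimage hP
  have hanti : IsClosed {w : W | Antitone (w.2.2ᵀ * Gmap g w.1 * w.2.2).diag} := by
    simp only [Antitone, ofPred_forall]
    exact isClosed_iInter fun i => isClosed_iInter fun j => isClosed_iInter fun _ =>
      isClosed_le (hPGP.matrix_elem j j) (hPGP.matrix_elem i i)
  have heq : IsClosed {w : W | Gmap g w.1 =
      w.2.2 * diagonal (w.2.2ᵀ * Gmap g w.1 * w.2.2).diag * w.2.2ᵀ} :=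
    isClosed_eq hG ((hP.matrix_mul hPGP.matrix_diag.matrix_diagonal).matrix_mul hPt)
  have htr : IsClosed {w : W | w.2.1.IsSymm} := isClosed_eq hΔ.matrix_transpose hΔ
  have hder : IsClosed {w : W | ∀ v, minner w.2.1 (fderiv ℝ g w.1.1 v) = 0} := by
    simp only [ofPred_forall]
    exact isClosed_iInter fun v =>
      isClosed_eq (hΔ.minner (hfd.clm_apply continuous_const)) continuous_const
  have htan : IsClosed {w : W | ∀ A : Mat n, A.IsSymm →
      minner w.2.1 (w.2.2 * (diagonal (fun i => max ((w.2.2ᵀ * Gmap g w.1 * w.2.2) i i) 0) * A +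
        A * diagonal (fun i => max ((w.2.2ᵀ * Gmap g w.1 * w.2.2) i i) 0)) * w.2.2ᵀ) = 0} := by
    simp only [ofPred_forall]
    exact isClosed_iInter fun A => isClosed_iInter fun _ =>
      isClosed_eq (hΔ.minner ((hP.matrix_mul ((hD.matrix_mul continuous_const).add
        (continuous_const.matrix_mul hD))).matrix_mul hPt)) continuous_const
  convert hort.inter (hanti.inter (heq.inter (htr.inter (hder.inter htan)))) using 1
  ext w
  exact ⟨fun ⟨ho, ⟨_, h1, h2⟩, h3, h4, h5⟩ => ⟨ho, h1, h2, h3, h4, h5⟩,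
    fun ⟨ho, h1, h2, h3, h4, h5⟩ => ⟨ho, ⟨ho, h1, h2⟩, h3, h4, h5⟩⟩

/-- Openness of the constraint nondegeneracy: if it holds at `z̄`, it holds
at every `z ∈ ℝᵐ × Sⁿ` in a neighborhood of `z̄`. -/
theorem CNondeg_open {m n : ℕ}
    (g : Em m → Mat n)
    (hg : ContDiff ℝ 2 g) (hgs : ∀ x, (g x).IsSymm)
    (zbar : Em m × Mat n) (hsym : zbar.2.IsSymm)
    (hC : CNondeg g zbar) :
    ∃ U : Set (Em m × Mat n), IsOpen U ∧ zbar ∈ U ∧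
      ∀ z ∈ U, z.2.IsSymm → CNondeg g z := by
  have hg1 : ContDiff ℝ 1 g := hg.of_le one_le_two
  have hK : IsCompact (Metric.sphere (0 : Mat n) 1 ×ˢ {P : Mat n | IsOrthoMat P}) := by
    have : ProperSpace (Mat n) := FiniteDimensional.proper ℝ _
    exact (isCompact_sphere _ _).prod (isCompact_setOf_isOrthoMat n)
  have hev : ∀ᶠ z in nhds zbar,
      ∀ y ∈ Metric.sphere (0 : Mat n) 1 ×ˢ {P : Mat n | IsOrthoMat P},
        ¬ (IsOrthoMat y.2 ∧ IsDegenerateAt g z y.1 y.2) := by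
    refine hK.eventually_forall_of_forall_eventually fun y hy => ?_
    refine (isClosed_setOf_isDegenerateAt hg1).isOpen_compl.mem_nhds fun hdeg => ?_
    have h1 : ‖y.1‖ = 1 := mem_sphere_zero_iff_norm.1 hy.1
    rw [hdeg.2.eq_zero hC, norm_zero] at h1
    exact zero_ne_one h1
  obtain ⟨U, hU, hUo, hzU⟩ := eventually_nhds_iff.1 hev
  refine ⟨U, hUo, hzU, fun z hz _ => ?_⟩
  by_contra hnot
  obtain ⟨Δ, P, hΔ, hP, hdeg⟩ :=
    exists_isDegenerateAt_of_not_cNondeg (hg1.differentiable one_ne_zero) hgs hnot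
  exact hU z hz (Δ, P) ⟨mem_sphere_zero_iff_norm.2 hΔ, hP⟩ ⟨hP, hdeg⟩
end
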